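/- arXiv:2309.06904 — 3 statements merged into one kernel-verified Lean document; each statement's English description precedes it below -/
import Mathlib

section
/- Let D=(V1,V2;A) be a split digraph such that every vertex of V1 has out-degree at least 3 and in-degree at least 3 in D, and let D* be a directed multigraph obtained from D by splitting off at most two pairs at every vertex of V1. If D*⟨V2⟩ is 2-arc-strong, then D has a strong arc decomposition. -/
/-- A digraph on vertex set `V` given by its arc set `A` is strong if every vertex
can reach every other vertex by a directed path. -/
def DigraphStrong {V : Type*} (A : Finset (V × V)) : Prop :=
  ∀ x y : V, Relation.ReflTransGen (fun a b => (a, b) ∈ A) x y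

/-- A digraph is `k`-arc-strong if it remains strong after deleting any set of
at most `k - 1` arcs. -/
def ArcStrong {V : Type*} [DecidableEq V] (k : ℕ) (A : Finset (V × V)) : Prop :=
  ∀ B ⊆ A, B.card < k → DigraphStrong (A \ B)

/-- A strong arc decomposition: a partition of the arc set into two disjoint sets,
each of which forms a strong spanning subdigraph. -/
def StrongArcDecomp {V : Type*} [DecidableEq V] (A : Finset (V × V)) : Prop :=
  ∃ A₁ A₂ : Finset (V × V), A₁ ∪ A₂ = A ∧ Disjoint A₁ A₂ ∧
    DigraphStrong A₁ ∧ DigraphStrong A₂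

/-- `(V₁, V₂; A)` is a split digraph: `V₁, V₂` are nonempty, partition the vertex set,
there are no loops, `V₁` is an independent set, and the subdigraph induced by `V₂`
is semicomplete. -/
def IsSplitDigraph {V : Type*} [Fintype V] [DecidableEq V]
    (V₁ V₂ : Finset V) (A : Finset (V × V)) : Prop :=
  V₁.Nonempty ∧ V₂.Nonempty ∧ Disjoint V₁ V₂ ∧ V₁ ∪ V₂ = Finset.univ ∧
  (∀ v : V, (v, v) ∉ A) ∧
  (∀ u ∈ V₁, ∀ v ∈ V₁, (u, v) ∉ A) ∧
  (∀ u ∈ V₂, ∀ v ∈ V₂, u ≠ v → (u, v) ∈ A ∨ (v, u) ∈ A)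

/-- The out-degree of a vertex. -/
def outDeg {V : Type*} [DecidableEq V] (A : Finset (V × V)) (t : V) : ℕ :=
  (A.filter fun e => e.1 = t).card

/-- The in-degree of a vertex. -/
def inDeg {V : Type*} [DecidableEq V] (A : Finset (V × V)) (t : V) : ℕ :=
  (A.filter fun e => e.2 = t).card

/-- In a directed multigraph with arc multiset `B`, every ordered pair of vertices
of `X` is joined by a directed path all of whose vertices lie in `X`. -/
def MStrongOn {V : Type*} (X : Finset V) (B : Multiset (V × V)) : Prop :=
  ∀ x ∈ X, ∀ y ∈ X, Relation.ReflTransGen (fun a b => a ∈ X ∧ b ∈ X ∧ (a, b) ∈ B) x y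

/-- The directed multigraph `B` is obtained from the split digraph `(V₁, V₂; A)` by
splitting off the pairs recorded in `S`: each element `(u, t, v)` of `S` stands for
splitting off the pair of arcs `(ut, tv)` at `t ∈ V₁` (with `u, v ∈ V₂`, `u ≠ v`),
i.e. deleting the arcs `ut` and `tv` and adding the (possibly parallel) arc `uv`.
The arcs used by the various splittings are pairwise distinct arcs of `A`. -/
def SplitsOff {V : Type*} [DecidableEq V] (A : Finset (V × V)) (V₁ V₂ : Finset V)
    (S : Multiset (V × V × V)) (B : Multiset (V × V)) : Prop :=
  (∀ s ∈ S, s.2.1 ∈ V₁ ∧ s.1 ∈ V₂ ∧ s.2.2 ∈ V₂ ∧ s.1 ≠ s.2.2 ∧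
    (s.1, s.2.1) ∈ A ∧ (s.2.1, s.2.2) ∈ A) ∧
  (S.bind fun s => {(s.1, s.2.1), (s.2.1, s.2.2)}).Nodup ∧
  B = (A.val - S.bind fun s => {(s.1, s.2.1), (s.2.1, s.2.2)}) +
      S.map fun s => (s.1, s.2.2)

/-- A directed multigraph restricted to `X` is `k`-arc-strong on `X`: it stays strong
on `X` after deleting any sub-multiset of fewer than `k` arcs. -/
def MArcStrongOn {V : Type*} [DecidableEq V] (k : ℕ) (X : Finset V) (B : Multiset (V × V)) : Prop :=
  ∀ C ≤ B, Multiset.card C < k → MStrongOn X (B - C)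

namespace ArcDecomp

/-! ### Cuts, connectivity and decompositions -/

section

variable {V : Type*}

/-- The multigraph `m` on `X` is semicomplete. -/
def Semi (X : Finset V) (m : V → V → ℕ) : Prop :=
  ∀ a ∈ X, ∀ b ∈ X, a ≠ b → 0 < m a b ∨ 0 < m b a

/-- The multigraph with all arcs reversed. -/
def rev (m : V → V → ℕ) : V → V → ℕ := fun a b => m b a

protected theorem Semi.rev {X : Finset V} {m : V → V → ℕ} (h : Semi X m) : Semi X (rev m) :=
  fun a ha b hb hab => (h a ha b hb hab).symm

variable [DecidableEq V]

/-- The number of arcs of the multigraph `m` on `X` that enter `U`. -/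
def cutIn (X : Finset V) (m : V → V → ℕ) (U : Finset V) : ℕ :=
  ∑ a ∈ X, ∑ b ∈ X, if a ∉ U ∧ b ∈ U then m a b else 0

/-- The multigraph `m` on `X` is `k`-arc-strong, in terms of cuts. -/
def KConn (k : ℕ) (X : Finset V) (m : V → V → ℕ) : Prop :=
  ∀ U ⊆ X, U.Nonempty → U ≠ X → k ≤ cutIn X m U

/-- The multigraph `m` on `X` contains two arc-disjoint strong spanning subdigraphs. -/
def Dec (X : Finset V) (m : V → V → ℕ) : Prop :=
  ∃ p q : V → V → ℕ, (∀ a ∈ X, ∀ b ∈ X, p a b + q a b ≤ m a b) ∧ KConn 1 X p ∧ KConn 1 X q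

variable {X U W Z : Finset V} {m p q s : V → V → ℕ} {x y : V}

theorem cutIn_pos : 0 < cutIn X m U ↔ ∃ a ∈ X, ∃ b ∈ X, a ∉ U ∧ b ∈ U ∧ 0 < m a b := by
  unfold cutIn
  constructor
  · intro h
    by_contra! hc
    refine absurd h (by
      rw [Finset.sum_eq_zero]
      · simp
      intro a ha
      refine Finset.sum_eq_zero fun b hb => ?_
      split_ifs with h
      · exact Nat.le_zero.1 (hc a ha b hb h.1 h.2)
      · rfl)
  · rintro ⟨a, ha, b, hb, h1, h2, h3⟩
    refine Finset.sum_pos' (fun _ _ => Nat.zero_le _) ⟨a, ha, ?_⟩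
    refine Finset.sum_pos' (fun _ _ => Nat.zero_le _) ⟨b, hb, ?_⟩
    simp [h1, h2, h3]

theorem KConn.exists_arc (h : KConn 1 X m) (hU : U ⊆ X) (hne : U.Nonempty) (hX : U ≠ X) :
    ∃ a ∈ X, ∃ b ∈ X, a ∉ U ∧ b ∈ U ∧ 0 < m a b :=
  cutIn_pos.1 (h U hU hne hX)

theorem KConn.of_exists_arc
    (h : ∀ U ⊆ X, U.Nonempty → U ≠ X → ∃ a ∈ X, ∃ b ∈ X, a ∉ U ∧ b ∈ U ∧ 0 < m a b) :
    KConn 1 X m := fun U hU hne hX => cutIn_pos.2 (h U hU hne hX)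

theorem not_kConn_one (h : ¬ KConn 1 X m) :
    ∃ U ⊆ X, U.Nonempty ∧ U ≠ X ∧ ∀ a ∈ X, a ∉ U → ∀ b ∈ U, m a b = 0 := by
  by_contra! hc
  refine h (.of_exists_arc fun U hU hne hX => ?_)
  obtain ⟨a, ha, haU, b, hb, hab⟩ := hc U hU hne hX
  exact ⟨a, ha, b, hU hb, haU, hb, Nat.pos_of_ne_zero hab⟩

theorem KConn.anti {k l : ℕ} (h : KConn k X m) (hl : l ≤ k) : KConn l X m :=
  fun U h1 h2 h3 => hl.trans (h U h1 h2 h3)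

theorem cutIn_mono (h : ∀ a ∈ X, ∀ b ∈ X, p a b ≤ m a b) : cutIn X p U ≤ cutIn X m U := by
  refine Finset.sum_le_sum fun a ha => Finset.sum_le_sum fun b hb => ?_
  split_ifs
  · exact h a ha b hb
  · rfl

theorem cutIn_rev : cutIn X (rev m) U = cutIn X m (X \ U) := by
  unfold cutIn rev
  rw [Finset.sum_comm]
  refine Finset.sum_congr rfl fun a ha => Finset.sum_congr rfl fun b hb => ?_
  simp [ha, hb, and_comm]

protected theorem KConn.rev {k : ℕ} (h : KConn k X m) : KConn k X (rev m) := by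
  intro U hU hne hX
  rw [cutIn_rev]
  refine h _ Finset.sdiff_subset ?_ ?_
  · rw [Finset.sdiff_nonempty]
    exact fun h' => hX (hU.antisymm h')
  · obtain ⟨u, hu⟩ := hne
    intro h'
    have : u ∈ X \ U := by rw [h']; exact hU hu
    simp [hu] at this

protected theorem Dec.rev (h : Dec X m) : Dec X (rev m) := by
  obtain ⟨p, q, h1, h2, h3⟩ := h
  exact ⟨rev p, rev q, fun a ha b hb => h1 b hb a ha, h2.rev, h3.rev⟩

theorem Dec.mono (h : Dec X p) (hp : ∀ a ∈ X, ∀ b ∈ X, p a b ≤ m a b) : Dec X m := by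
  obtain ⟨p', q', h1, h2, h3⟩ := h
  exact ⟨p', q', fun a ha b hb => (h1 a ha b hb).trans (hp a ha b hb), h2, h3⟩

theorem cutIn_erase (hy : y ∈ X) (hU : U ⊆ X.erase y) :
    cutIn X m U = cutIn (X.erase y) m U + ∑ b ∈ U, m y b := by
  have hyU : y ∉ U := fun h => by simpa using hU h
  unfold cutIn
  rw [← Finset.sum_erase_add _ _ hy]
  congr 1
  · refine Finset.sum_congr rfl fun a ha => ?_
    rw [← Finset.sum_erase_add _ _ hy]
    simp [hyU]
  · simp only [hyU, not_false_eq_true, true_and]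
    rw [← Finset.sum_filter]
    refine Finset.sum_congr ?_ fun _ _ => rfl
    ext b
    simp only [Finset.mem_filter]
    exact ⟨fun h => h.2, fun h => ⟨Finset.mem_of_mem_erase (hU h), h⟩⟩

theorem exists_arc_of_cutIn_erase_lt (hy : y ∈ X) (hU : U ⊆ X.erase y)
    (h : cutIn (X.erase y) m U < cutIn X m U) : ∃ b ∈ U, 0 < m y b := by
  by_contra! hc
  rw [cutIn_erase hy hU, Finset.sum_eq_zero fun b hb => Nat.le_zero.1 (hc b hb)] at h
  simp at h

theorem cutIn_le_of_unique {w u : V}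
    (h : ∀ a ∈ X, a ∉ U → ∀ b ∈ U, 0 < m a b → a = w ∧ b = u) : cutIn X m U ≤ m w u := by
  calc cutIn X m U ≤ ∑ a ∈ X, ∑ b ∈ X, if a = w then if b = u then m w u else 0 else 0 := by
        refine Finset.sum_le_sum fun a ha => Finset.sum_le_sum fun b hb => ?_
        by_cases hab : a ∉ U ∧ b ∈ U
        · rcases Nat.eq_zero_or_pos (m a b) with h0 | h0
          · simp [h0]
          · obtain ⟨rfl, rfl⟩ := h a ha hab.1 b hab.2 h0
            simp [hab]
        · simp [hab]
    _ ≤ m w u := by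
        simp only [Finset.sum_ite_eq', Finset.sum_ite_irrel, Finset.sum_const_zero]
        split_ifs <;> simp

theorem KConn.exists_other (h : KConn 2 X m) {w u : V} (hwu : m w u ≤ 1) (hU : U ⊆ X)
    (hne : U.Nonempty) (hX : U ≠ X) :
    ∃ a ∈ X, a ∉ U ∧ ∃ b ∈ U, 0 < m a b ∧ (a = w → b ≠ u) := by
  by_contra! hc
  have := cutIn_le_of_unique (X := X) (U := U) (m := m) (w := w) (u := u)
    fun a ha haU b hb hab => hc a ha haU b hb hab
  have := h U hU hne hX
  omega

theorem cutIn_inter_add_cutIn_union :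
    cutIn X m (U ∩ W) + cutIn X m (U ∪ W) ≤ cutIn X m U + cutIn X m W := by
  unfold cutIn
  simp only [← Finset.sum_add_distrib]
  refine Finset.sum_le_sum fun a _ => Finset.sum_le_sum fun b _ => ?_
  by_cases h1 : a ∈ U <;> by_cases h2 : b ∈ U <;> by_cases h3 : a ∈ W <;> by_cases h4 : b ∈ W <;>
    simp [h1, h2, h3, h4]

end

/-! ### Undoing splittings -/

section

variable {V : Type*}

theorem exists_split_vector {X : Finset V} {r₁ r₂ c : V → ℕ} (h : ∀ u ∈ X, r₁ u + r₂ u ≤ c u)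
    (h2 : 2 ≤ ∑ u ∈ X, c u) (h3 : ∑ u ∈ X, r₁ u + ∑ u ∈ X, r₂ u + 1 ≤ ∑ u ∈ X, c u) :
    ∃ i₁ i₂ : V → ℕ, (∀ u ∈ X, r₁ u ≤ i₁ u ∧ r₂ u ≤ i₂ u ∧ i₁ u + i₂ u ≤ c u) ∧
      (∃ u ∈ X, 0 < i₁ u) ∧ ∃ u ∈ X, 0 < i₂ u := by
  classical
  have key : ∀ r : V → ℕ, (∀ u ∈ X, r u ≤ c u) → ∑ u ∈ X, r u < ∑ u ∈ X, c u →
      ∃ i₁ i₂ : V → ℕ, (∀ u ∈ X, r u ≤ i₂ u ∧ i₁ u + i₂ u ≤ c u) ∧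
        (∃ u ∈ X, 0 < i₁ u) ∧ ∃ u ∈ X, 0 < i₂ u := by
    intro r hr hlt
    obtain ⟨u₀, hu₀, hlt⟩ := Finset.exists_lt_of_sum_lt hlt
    refine ⟨fun u => if u = u₀ then 1 else 0, fun u => c u - if u = u₀ then 1 else 0,
      fun u hu => ?_, ⟨u₀, hu₀, by simp⟩, ?_⟩
    · have := hr u hu
      by_cases h : u = u₀
      · subst h
        simp
        omega
      · simpa [h]
    · by_contra! hc
      have : ∑ u ∈ X, c u ≤ ∑ u ∈ X, if u = u₀ then 1 else 0 :=
        Finset.sum_le_sum fun u hu => by have := hc u hu; omega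
      simp [hu₀] at this
      omega
  by_cases h1 : ∃ u ∈ X, 0 < r₁ u
  · by_cases h2 : ∃ u ∈ X, 0 < r₂ u
    · exact ⟨r₁, r₂, fun u hu => ⟨le_rfl, le_rfl, h u hu⟩, h1, h2⟩
    · push Not at h2
      obtain ⟨i, j, h4, h5, h6⟩ := key r₁ (fun u hu => by have := h u hu; omega) (by omega)
      refine ⟨j, i, fun u hu => ?_, h6, h5⟩
      have := h4 u hu
      have := h2 u hu
      omega
  · push Not at h1
    obtain ⟨i, j, h4, h5, h6⟩ := key r₂ (fun u hu => by have := h u hu; omega) (by omega)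
    refine ⟨i, j, fun u hu => ?_, h5, h6⟩
    have := h4 u hu
    have := h1 u hu
    omega

variable [DecidableEq V] {X : Finset V} {m p s : V → V → ℕ} {x : V}

/-- Remove the multigraph `s` from `p` and add a vertex `x` with in-arcs `i` and out-arcs `o`. -/
def attach (p s : V → V → ℕ) (x : V) (i o : V → ℕ) : V → V → ℕ := fun a b =>
  if a = x then if b = x then 0 else o b else if b = x then i a else p a b - s a b

protected theorem KConn.attach (h : KConn 1 X p) (hx : x ∉ X) {i o : V → ℕ}
    (hs : ∀ u ∈ X, ∀ v ∈ X, 0 < s u v → 0 < i u ∧ 0 < o v)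
    (hi' : ∃ u ∈ X, 0 < i u) (ho' : ∃ u ∈ X, 0 < o u) :
    KConn 1 (insert x X) (attach p s x i o) := by
  have hxn : ∀ u ∈ X, u ≠ x := fun u hu h => hx (h ▸ hu)
  refine .of_exists_arc fun U hU hne hUX => ?_
  simp only [Finset.exists_mem_insert]
  by_cases h0 : U ∩ X = ∅
  · obtain ⟨u, hu, h1⟩ := hi'
    have hdis : ∀ v ∈ X, v ∉ U := fun v hv hvU => by
      have : v ∈ U ∩ X := by simp [hv, hvU]
      simp [h0] at this
    obtain ⟨z, hz⟩ := hne
    have hzx : z = x := by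
      rcases Finset.mem_insert.1 (hU hz) with h | h
      · exact h
      · exact absurd hz (hdis z h)
    subst hzx
    exact .inr ⟨u, hu, .inl ⟨hdis u hu, hz, by simp [attach, hxn u hu, h1]⟩⟩
  by_cases h1 : U ∩ X = X
  · have hXU : X ⊆ U := Finset.inter_eq_right.1 h1
    obtain ⟨u, hu, h1⟩ := ho'
    have hxU : x ∉ U := fun h => hUX (hU.antisymm (Finset.insert_subset h hXU))
    exact .inl (.inr ⟨u, hu, hxU, hXU hu, by simp [attach, hxn u hu, h1]⟩)
  obtain ⟨u, hu, v, hv, huU, hvU, huv⟩ := h.exists_arc (U := U ∩ X) Finset.inter_subset_right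
    (Finset.nonempty_iff_ne_empty.2 h0) h1
  simp only [Finset.mem_inter, hu, and_true, hv] at huU hvU
  by_cases h2 : 0 < p u v - s u v
  · exact .inr ⟨u, hu, .inr ⟨v, hv, huU, hvU, by simp [attach, hxn u hu, hxn v hv, h2]⟩⟩
  obtain ⟨h3, h4⟩ := hs u hu v hv (by omega)
  by_cases hxU : x ∈ U
  · exact .inr ⟨u, hu, .inl ⟨huU, hxU, by simpa [attach, hxn u hu]⟩⟩
  · exact .inl (.inr ⟨v, hv, hxU, hvU, by simpa [attach, hxn v hv]⟩)

/-- Undoing a set `s` of splittings at the vertex `x`. -/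
theorem Dec.unsplit (h : Dec X (m + s)) (hx : x ∉ X)
    (hr : ∀ u ∈ X, ∑ v ∈ X, s u v ≤ m u x) (hc : ∀ v ∈ X, ∑ u ∈ X, s u v ≤ m x v)
    (hin : 2 ≤ ∑ u ∈ X, m u x) (hin' : ∑ u ∈ X, ∑ v ∈ X, s u v + 1 ≤ ∑ u ∈ X, m u x)
    (hout : 2 ≤ ∑ u ∈ X, m x u) (hout' : ∑ u ∈ X, ∑ v ∈ X, s u v + 1 ≤ ∑ u ∈ X, m x u) :
    Dec (insert x X) m := by
  obtain ⟨p, q, hpq, hp, hq⟩ := h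
  let s₁ : V → V → ℕ := fun u v => min (p u v) (s u v)
  let s₂ : V → V → ℕ := fun u v => min (q u v) (s u v - s₁ u v)
  have hs : ∀ u v, s₁ u v + s₂ u v ≤ s u v := fun u v => by simp only [s₁, s₂]; omega
  have hrow : ∀ u, ∑ v ∈ X, s₁ u v + ∑ v ∈ X, s₂ u v ≤ ∑ v ∈ X, s u v := fun u => by
    rw [← Finset.sum_add_distrib]
    exact Finset.sum_le_sum fun v _ => hs u v
  have hcol : ∀ v, ∑ u ∈ X, s₁ u v + ∑ u ∈ X, s₂ u v ≤ ∑ u ∈ X, s u v := fun v => by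
    rw [← Finset.sum_add_distrib]
    exact Finset.sum_le_sum fun u _ => hs u v
  obtain ⟨i₁, i₂, hi, hi₁, hi₂⟩ := exists_split_vector (X := X) (r₁ := fun u => ∑ v ∈ X, s₁ u v)
    (r₂ := fun u => ∑ v ∈ X, s₂ u v) (c := fun u => m u x)
    (fun u hu => (hrow u).trans (hr u hu)) hin (by
      refine le_trans ?_ hin'
      rw [← Finset.sum_add_distrib]
      gcongr
      exact hrow _)
  obtain ⟨o₁, o₂, ho, ho₁, ho₂⟩ := exists_split_vector (X := X) (r₁ := fun v => ∑ u ∈ X, s₁ u v)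
    (r₂ := fun v => ∑ u ∈ X, s₂ u v) (c := fun v => m x v)
    (fun u hu => (hcol u).trans (hc u hu)) hout (by
      refine le_trans ?_ hout'
      rw [← Finset.sum_add_distrib, Finset.sum_comm (f := s)]
      gcongr
      exact hcol _)
  refine ⟨attach p s₁ x i₁ o₁, attach q s₂ x i₂ o₂, fun a ha b hb => ?_,
    hp.attach hx (fun u hu v hv h => ⟨(h.trans_le (Finset.single_le_sum (f := fun v => s₁ u v)
      (fun _ _ => Nat.zero_le _) hv)).trans_le (hi u hu).1,
      (h.trans_le (Finset.single_le_sum (f := fun u => s₁ u v)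
      (fun _ _ => Nat.zero_le _) hu)).trans_le (ho v hv).1⟩) hi₁ ho₁,
    hq.attach hx (fun u hu v hv h => ⟨(h.trans_le (Finset.single_le_sum (f := fun v => s₂ u v)
      (fun _ _ => Nat.zero_le _) hv)).trans_le (hi u hu).2.1,
      (h.trans_le (Finset.single_le_sum (f := fun u => s₂ u v)
      (fun _ _ => Nat.zero_le _) hu)).trans_le (ho v hv).2.1⟩) hi₂ ho₂⟩
  unfold attach
  by_cases hax : a = x
  · by_cases hbx : b = x
    · simp [hax, hbx]
    · simpa [hax, hbx] using (ho b (Finset.mem_of_mem_insert_of_ne hb hbx)).2.2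
  · by_cases hbx : b = x
    · simpa [hax, hbx] using (hi a (Finset.mem_of_mem_insert_of_ne ha hax)).2.2
    · have := hpq a (Finset.mem_of_mem_insert_of_ne ha hax) b
        (Finset.mem_of_mem_insert_of_ne hb hbx)
      simp only [hax, hbx, if_false, s₁, s₂, Pi.add_apply] at this ⊢
      omega

end

/-! ### Contraction -/

section

variable {V : Type*} [DecidableEq V] {X : Finset V} {m : V → V → ℕ} {x u : V}

/-- Contract the arc from `x` to `u`, discarding loops, when `x` is the only in-neighbour of `u`. -/
def contract (m : V → V → ℕ) (x u : V) : V → V → ℕ := fun a b =>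
  if a = x then if b = x then 0 else m x b + m u b else m a b

protected theorem Semi.contract (h : Semi X m) : Semi (X.erase u) (contract m x u) := by
  intro a ha b hb hab
  have := h a (Finset.mem_of_mem_erase ha) b (Finset.mem_of_mem_erase hb) hab
  unfold contract
  split_ifs <;> first | omega | (subst_vars; simp_all; try omega)

protected theorem KConn.contract (h : KConn 2 X m) (hx : x ∈ X) (hu : u ∈ X) (hxu : x ≠ u)
    (hN : ∀ a ∈ X, a ≠ x → m a u = 0) : KConn 2 (X.erase u) (contract m x u) := by
  intro U hU hne hUX
  have huU : u ∉ U := fun h => by simpa using hU h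
  by_cases hxU : x ∈ U
  · refine (h (insert u U) (Finset.insert_subset hu (hU.trans (Finset.erase_subset _ _)))
      (by simp) ?_).trans ?_
    · rintro rfl
      exact hUX (Finset.erase_insert huU).symm
    unfold cutIn
    rw [← Finset.sum_erase_add _ _ hu, Finset.sum_eq_zero (s := X) (by simp), add_zero]
    refine Finset.sum_le_sum fun a ha => ?_
    rw [← Finset.sum_erase_add _ _ hu]
    by_cases hax : a = x
    · simp [hax, hxU]
    have := hN a (Finset.mem_of_mem_erase ha) hax
    simp only [this, ite_self, add_zero]
    refine Finset.sum_le_sum fun b hb => ?_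
    have := Finset.ne_of_mem_erase ha
    have := Finset.ne_of_mem_erase hb
    simp [*, contract]
  · have hU' : U ⊆ (X.erase u).erase x := fun z hz =>
      Finset.mem_erase.2 ⟨fun h => hxU (h ▸ hz), hU hz⟩
    have h1 := h U (hU.trans (Finset.erase_subset _ _)) hne (fun h => huU (h ▸ hu))
    have hx' : x ∈ X.erase u := Finset.mem_erase.2 ⟨hxu, hx⟩
    rw [cutIn_erase hu hU, cutIn_erase hx' hU'] at h1
    rw [cutIn_erase hx' hU']
    refine h1.trans ?_
    rw [add_assoc, ← Finset.sum_add_distrib]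
    refine add_le_add (cutIn_mono fun a ha b hb => ?_) (Finset.sum_le_sum fun b hb => ?_)
    · have := Finset.ne_of_mem_erase ha
      simp [contract, this]
    · have : b ≠ x := fun h => hxU (h ▸ hb)
      simp [contract, this]

theorem Dec.of_contract (hd : Dec (X.erase u) (contract m x u)) (h : KConn 2 X m) (hs : Semi X m)
    (hX : 4 ≤ X.card) (hx : x ∈ X) (hu : u ∈ X) (hxu : x ≠ u)
    (hN : ∀ a ∈ X, a ≠ x → m a u = 0) : Dec X m := by
  obtain ⟨p, q, hpq, hp, hq⟩ := hd
  set Y := (X.erase u).erase x with hY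
  have hx' : x ∈ X.erase u := Finset.mem_erase.2 ⟨hxu, hx⟩
  have hYc : 2 ≤ Y.card := by
    rw [hY, Finset.card_erase_of_mem hx', Finset.card_erase_of_mem hu]
    omega
  have hxm : 2 ≤ m x u := by
    refine (h {u} (by simpa) (by simp) ?_).trans (cutIn_le_of_unique fun a ha _ b hb hab => ?_)
    · rintro rfl
      simp at hX
    · rw [Finset.mem_singleton] at hb
      subst hb
      exact ⟨by_contra fun h => by simp [hN a ha h] at hab, rfl⟩
  have hum : ∀ v ∈ Y, 0 < m u v := by
    intro v hv
    simp only [hY, Finset.mem_erase] at hv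
    have := hs u hu v hv.2.2 hv.2.1.symm
    have := hN v hv.2.2 hv.1
    omega
  have key : ∀ r : V → V → ℕ, KConn 1 (X.erase u) r → ∃ v ∈ Y, 0 < r x v := by
    intro r hr
    obtain ⟨a, ha, b, hb, haY, hbY, hab⟩ := hr.exists_arc (U := Y) (Finset.erase_subset _ _)
      (Finset.card_pos.1 (by omega)) (fun h => by
        have : x ∈ Y := h ▸ hx'
        simp [hY] at this)
    have : a = x := by simpa [hY, ha] using haY
    exact ⟨b, hbY, this ▸ hab⟩
  obtain ⟨v₁, hv₁, v₂, hv₂, hv, hA, hB⟩ : ∃ v₁ ∈ Y, ∃ v₂ ∈ Y, v₁ ≠ v₂ ∧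
      (0 < p x v₁ ∨ q x v₁ = 0) ∧ (0 < q x v₂ ∨ p x v₂ = 0) := by
    obtain ⟨v, hv, hpv⟩ := key p hp
    obtain ⟨w, hw, hqw⟩ := key q hq
    by_cases hvw : v = w
    · subst hvw
      obtain ⟨w, hw, hne⟩ := Finset.exists_mem_ne (by omega : 1 < Y.card) v
      rcases Nat.eq_zero_or_pos (p x w) with h0 | h0
      · exact ⟨v, hv, w, hw, hne.symm, .inl hpv, .inr h0⟩
      · exact ⟨w, hw, v, hv, hne, .inl h0, .inl hqw⟩
    · exact ⟨v, hv, w, hw, hvw, .inl hpv, .inl hqw⟩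
  have hpqx : ∀ v ∈ Y, p x v + q x v ≤ m x v + m u v := fun v hv => by
    have := hpq x hx' v (Finset.mem_of_mem_erase hv)
    simpa [contract, Finset.ne_of_mem_erase hv] using this
  have : ∀ v, ∃ i j, i + j ≤ m u v ∧ (v ∈ Y → p x v - i + (q x v - j) ≤ m x v) ∧
      (v = v₁ → 0 < i) ∧ (v = v₂ → 0 < j) := by
    intro v
    by_cases hvY : v ∈ Y
    · have h1 := hum v hvY
      have h2 := hpqx v hvY
      by_cases hv1 : v = v₁
      · subst hv1
        by_cases h0 : 0 < p x v
        · exact ⟨min (p x v) (m u v), min (q x v) (m u v - min (p x v) (m u v)), by omega,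
            fun _ => by omega, fun _ => by omega, fun h => absurd h hv⟩
        · exact ⟨m u v, 0, by omega, fun _ => by omega, fun _ => by omega, fun h => absurd h hv⟩
      by_cases hv2 : v = v₂
      · subst hv2
        by_cases h0 : 0 < q x v
        · exact ⟨min (p x v) (m u v - min (q x v) (m u v)), min (q x v) (m u v), by omega,
            fun _ => by omega, fun h => absurd h hv1, fun _ => by omega⟩
        · exact ⟨0, m u v, by omega, fun _ => by omega, fun h => absurd h hv1, fun _ => by omega⟩
      · exact ⟨min (p x v) (m u v), min (q x v) (m u v - min (p x v) (m u v)), by omega,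
            fun _ => by omega, fun h => absurd h hv1, fun h => absurd h hv2⟩
    · exact ⟨0, 0, by omega, fun h => absurd h hvY, fun h => absurd (h ▸ hv₁) hvY,
        fun h => absurd (h ▸ hv₂) hvY⟩
  choose i j hij hijx hi hj using this
  have hattach : ∀ (r : V → V → ℕ) (k : V → ℕ) (v : V), v ∈ Y → 0 < k v → KConn 1 (X.erase u) r →
      KConn 1 X (attach r (fun a b => if a = x then k b else 0) u (fun a => if a = x then 1 else 0)
        k) := by
    intro r k v hv hk hr
    have := hr.attach (x := u) (s := fun a b => if a = x then k b else 0)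
      (i := fun a => if a = x then 1 else 0) (o := k) (by simp)
      (fun a _ b _ hab => by
        split_ifs at hab ⊢ with h
        · exact ⟨Nat.one_pos, hab⟩
        · omega)
      ⟨x, hx', by simp⟩ ⟨v, Finset.mem_of_mem_erase hv, hk⟩
    rwa [Finset.insert_erase hu] at this
  refine ⟨_, _, fun a ha b hb => ?_, hattach p i v₁ hv₁ (hi _ rfl) hp,
    hattach q j v₂ hv₂ (hj _ rfl) hq⟩
  unfold attach
  by_cases hau : a = u
  · subst hau
    by_cases hba : b = a
    · simp [hba]
    · simpa [hba] using hij b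
  by_cases hbu : b = u
  · subst hbu
    by_cases hax : a = x
    · subst hax
      simpa [hau]
    · simp [hau, hax]
  have ha' : a ∈ X.erase u := Finset.mem_erase.2 ⟨hau, ha⟩
  have hb' : b ∈ X.erase u := Finset.mem_erase.2 ⟨hbu, hb⟩
  have h1 := hpq a ha' b hb'
  simp only [hau, hbu, if_false]
  by_cases hax : a = x
  · subst hax
    by_cases hbx : b = a
    · subst hbx
      simp [contract] at h1 ⊢
      omega
    · simpa using hijx b (Finset.mem_erase.2 ⟨hbx, hb'⟩)
  · simpa [contract, hax] using h1

end

/-! ### Admissible splittings -/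

section

variable {V : Type*} [DecidableEq V] {X Z : Finset V} {m : V → V → ℕ} {y : V}

/-- No two disjoint sets have in-cuts of size at most one. -/
def TightMeet (Z : Finset V) (m : V → V → ℕ) : Prop :=
  ∀ U ⊆ Z, U.Nonempty → ∀ W ⊆ Z, W.Nonempty → cutIn Z m U ≤ 1 → cutIn Z m W ≤ 1 →
    ¬ Disjoint U W

theorem cutIn_add (X : Finset V) (m s : V → V → ℕ) (U : Finset V) :
    cutIn X (m + s) U = cutIn X m U + cutIn X s U := by
  unfold cutIn
  simp only [← Finset.sum_add_distrib, Pi.add_apply]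
  refine Finset.sum_congr rfl fun a _ => Finset.sum_congr rfl fun b _ => ?_
  split_ifs <;> rfl

theorem KConn.two_le_outDeg (h : KConn 2 X m) (hy : y ∈ X) (hX : 2 ≤ X.card) :
    2 ≤ ∑ u ∈ X.erase y, m y u := by
  have h1 := h (X.erase y) (Finset.erase_subset _ _)
    (Finset.card_pos.1 (by rw [Finset.card_erase_of_mem hy]; omega)) (by simpa)
  rw [cutIn_erase hy subset_rfl] at h1
  have : cutIn (X.erase y) m (X.erase y) = 0 := Finset.sum_eq_zero fun a ha =>
    Finset.sum_eq_zero fun b _ => by simp only [ha, not_true, false_and, if_false]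
  omega

/-- If deleting `y` leaves a sufficiently connected multigraph, then at most one splitting at `y`
produces a 2-arc-strong one. -/
theorem KConn.exists_splitting (h : KConn 2 X m) (hy : y ∈ X) (h1 : KConn 1 (X.erase y) m)
    (hp : TightMeet (X.erase y) m) (hp' : TightMeet (X.erase y) (rev m)) :
    KConn 2 (X.erase y) m ∨ ∃ u ∈ X.erase y, ∃ v ∈ X.erase y, 0 < m u y ∧ 0 < m y v ∧
      KConn 2 (X.erase y) (m + fun a b => if a = u ∧ b = v then 1 else 0) := by
  set Z := X.erase y with hZ
  let T := Z.powerset.filter fun U => U.Nonempty ∧ U ≠ Z ∧ cutIn Z m U ≤ 1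
  have memT : ∀ {U}, U ∈ T ↔ U ⊆ Z ∧ U.Nonempty ∧ U ≠ Z ∧ cutIn Z m U ≤ 1 := by simp [T]
  by_cases hT : T.Nonempty
  swap
  · refine .inl fun U hU hne hUZ => ?_
    by_contra hc
    exact hT ⟨U, memT.2 ⟨hU, hne, hUZ, by omega⟩⟩
  have hXne : ∀ {U}, U ⊆ Z → U ≠ X := fun {U} hU h => by
    subst h
    simpa [hZ] using hU hy
  have hcompl : ∀ {U}, U ∈ T → (Z \ U).Nonempty ∧ cutIn Z (rev m) (Z \ U) ≤ 1 := fun hU => by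
    obtain ⟨h1, -, h3, h4⟩ := memT.1 hU
    refine ⟨Finset.sdiff_nonempty.2 fun h => h3 (h1.antisymm h), ?_⟩
    rwa [cutIn_rev, Finset.sdiff_sdiff_eq_self h1]
  have hTT : ∀ {U W}, U ∈ T → W ∈ T → U ∩ W ∈ T ∧ U ∪ W ∈ T := by
    intro U W hU hW
    have ⟨a1, a2, a3, a4⟩ := memT.1 hU
    have ⟨b1, b2, b3, b4⟩ := memT.1 hW
    have c1 : (U ∩ W).Nonempty :=
      Finset.not_disjoint_iff_nonempty_inter.1 (hp U a1 a2 W b1 b2 a4 b4)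
    have c2 : U ∩ W ≠ Z := fun h => a3 (a1.antisymm (h ▸ Finset.inter_subset_left))
    have d2 : U ∪ W ≠ Z := by
      intro h
      refine hp' (Z \ U) Finset.sdiff_subset (hcompl hU).1 (Z \ W) Finset.sdiff_subset
        (hcompl hW).1 (hcompl hU).2 (hcompl hW).2 ?_
      rw [Finset.disjoint_iff_inter_eq_empty, ← Finset.sdiff_union_distrib, h, Finset.sdiff_self]
    have e1 : U ∩ W ⊆ Z := Finset.inter_subset_left.trans a1
    have e2 : U ∪ W ⊆ Z := Finset.union_subset a1 b1
    have f1 := h1 _ e1 c1 c2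
    have f2 := h1 _ e2 (a2.mono Finset.subset_union_left) d2
    have := cutIn_inter_add_cutIn_union (X := Z) (m := m) (U := U) (W := W)
    exact ⟨memT.2 ⟨e1, c1, c2, by omega⟩,
      memT.2 ⟨e2, a2.mono Finset.subset_union_left, d2, by omega⟩⟩
  obtain ⟨P, hPT, hP⟩ := T.exists_min_image Finset.card hT
  obtain ⟨Q, hQT, hQ⟩ := T.exists_max_image Finset.card hT
  have hP' : ∀ U ∈ T, P ⊆ U := fun U hU => by
    have := Finset.eq_of_subset_of_card_le (Finset.inter_subset_left (s₁ := P) (s₂ := U))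
      (hP _ (hTT hPT hU).1)
    rw [← this]
    exact Finset.inter_subset_right
  have hQ' : ∀ U ∈ T, U ⊆ Q := fun U hU => by
    have := Finset.eq_of_subset_of_card_le (Finset.subset_union_left (s₁ := Q) (s₂ := U))
      (hQ _ (hTT hQT hU).2)
    rw [this]
    exact Finset.subset_union_right
  obtain ⟨hPZ, hPne, hPZ', hPc⟩ := memT.1 hPT
  obtain ⟨v, hvP, hyv⟩ := exists_arc_of_cutIn_erase_lt (m := m) hy hPZ
    (by
        have := h P (hPZ.trans (Finset.erase_subset _ _)) hPne (hXne hPZ)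
        rw [← hZ]
        omega)
  obtain ⟨u, huQ, hyu⟩ := exists_arc_of_cutIn_erase_lt (m := rev m) hy
    (Finset.sdiff_subset : Z \ Q ⊆ Z) (by
      have := h.rev (Z \ Q) (Finset.sdiff_subset.trans (Finset.erase_subset _ _)) (hcompl hQT).1
        (hXne Finset.sdiff_subset)
      have := (hcompl hQT).2
      rw [← hZ]
      omega)
  rw [Finset.mem_sdiff] at huQ
  refine .inr ⟨u, huQ.1, v, hPZ hvP, hyu, hyv, fun U hU hne hUZ => ?_⟩
  rw [cutIn_add]
  by_cases hc : cutIn Z m U ≤ 1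
  · have hUT : U ∈ T := memT.2 ⟨hU, hne, hUZ, hc⟩
    have := h1 U hU hne hUZ
    refine add_le_add this (cutIn_pos.2 ⟨u, huQ.1, v, hPZ hvP, fun h => huQ.2 (hQ' _ hUT h),
      hP' _ hUT hvP, by simp⟩)
  · omega

theorem Dec.of_exists_splitting (hdec : ∀ m' : V → V → ℕ, (∀ a b, m a b ≤ m' a b) →
      KConn 2 (X.erase y) m' → Dec (X.erase y) m')
    (h : KConn 2 X m) (hy : y ∈ X) (hX : 2 ≤ X.card) (h1 : KConn 1 (X.erase y) m)
    (hp : TightMeet (X.erase y) m) (hp' : TightMeet (X.erase y) (rev m)) : Dec X m := by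
  have ho := h.two_le_outDeg hy hX
  have hi := h.rev.two_le_outDeg hy hX
  rw [← Finset.insert_erase hy]
  obtain h2 | ⟨u, hu, v, hv, huy, hyv, h2⟩ := h.exists_splitting hy h1 hp hp'
  · refine Dec.unsplit (s := 0) (by simpa using hdec m (fun _ _ => le_rfl) h2) (by simp) (by simp)
      (by simp) hi ?_ ho ?_ <;> simp only [Pi.zero_apply, Finset.sum_const_zero]
    · exact le_trans (by simp) hi
    · exact le_trans (by simp) ho
  · have hs : ∑ a ∈ X.erase y, ∑ b ∈ X.erase y, (if a = u ∧ b = v then 1 else 0) ≤ 1 := by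
      simp only [ite_and, Finset.sum_ite_irrel, Finset.sum_const_zero, Finset.sum_ite_eq']
      split_ifs
      simp
    refine Dec.unsplit (hdec _ (fun a b => Nat.le_add_right _ _) h2) (by simp) (fun a _ => ?_)
      (fun b _ => ?_) hi ((Nat.add_le_add_right hs 1).trans hi) ho
      ((Nat.add_le_add_right hs 1).trans ho)
    · by_cases ha : a = u
      · subst ha
        simp only [true_and, Finset.sum_ite_eq', hv, if_true]
        exact huy
      · simp [ha]
    · by_cases hb : b = v
      · subst hb
        simp only [and_true, Finset.sum_ite_eq', hu, if_true]
        exact hyv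
      · simp [hb]

end

/-! ### Obstructions to splitting -/

section

variable {V : Type*} [DecidableEq V] {X Z U K : Finset V} {m : V → V → ℕ} {y u₁ u₂ w : V}

theorem cutIn_le_one (h : cutIn X m U ≤ 1) {a b a' b' : V} (ha : a ∈ X) (hb : b ∈ X)
    (haU : a ∉ U) (hbU : b ∈ U) (hab : 0 < m a b) (ha' : a' ∈ X) (hb' : b' ∈ X)
    (haU' : a' ∉ U) (hbU' : b' ∈ U) (hab' : 0 < m a' b') : m a b = 1 ∧ a' = a ∧ b' = b := by
  unfold cutIn at h
  rw [← Finset.sum_product' (f := fun a b => if a ∉ U ∧ b ∈ U then m a b else 0)] at h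
  have h1 : m a b ≤ 1 := by
    refine le_trans ?_ h
    refine le_trans (b := if a ∉ U ∧ b ∈ U then m a b else 0) (by simp [haU, hbU]) ?_
    exact Finset.single_le_sum (f := fun e : V × V => if e.1 ∉ U ∧ e.2 ∈ U then m e.1 e.2 else 0)
      (a := (a, b)) (fun _ _ => Nat.zero_le _) (by simp [ha, hb])
  refine ⟨by omega, ?_⟩
  by_contra hne
  have h2 := (Finset.sum_le_sum_of_subset
    (f := fun e : V × V => if e.1 ∉ U ∧ e.2 ∈ U then m e.1 e.2 else 0)
    (show {(a, b), (a', b')} ⊆ X ×ˢ X by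
      simp [Finset.insert_subset_iff, ha, hb, ha', hb'])).trans h
  rw [Finset.sum_pair (by
    intro h
    simp only [Prod.mk.injEq] at h
    exact hne ⟨h.1.symm, h.2.symm⟩)] at h2
  simp only [haU, hbU, haU', hbU', not_false_eq_true, true_and, if_true] at h2
  omega

/-- The in-neighbourhoods of `u₂` and `u₁` are `{y, u₁}` and `{y, w}`, and the arc from `w` to `u₁`
is simple. -/
structure InPattern (X : Finset V) (m : V → V → ℕ) (y u₁ u₂ w : V) : Prop where
  mem₁ : u₁ ∈ X
  mem₂ : u₂ ∈ X
  mem_w : w ∈ X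
  ne₁ : u₁ ≠ y
  ne₂ : u₂ ≠ y
  ne₁₂ : u₁ ≠ u₂
  ne_w : w ≠ y
  ne_w₁ : w ≠ u₁
  ne_w₂ : w ≠ u₂
  in₂ : ∀ a ∈ X, 0 < m a u₂ ↔ a = y ∨ a = u₁
  in₁ : ∀ a ∈ X, 0 < m a u₁ ↔ a = y ∨ a = w
  mul : m w u₁ = 1

theorem KConn.exists_inPattern_of_arc (h : KConn 2 X m) (hs : Semi X m) (hl : ∀ a, m a a = 0)
    (hX : 6 ≤ X.card) (hy : y ∈ X) (h1 : KConn 1 (X.erase y) m) {U W : Finset V}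
    (hU : U ⊆ X.erase y) (hW : W ⊆ X.erase y)
    (hUc : cutIn (X.erase y) m U ≤ 1) (hWc : cutIn (X.erase y) m W ≤ 1) (hUW : Disjoint U W)
    (hu₁ : u₁ ∈ U) (hu₂ : u₂ ∈ W) (hu : 0 < m u₁ u₂) :
    ∃ u₁ u₂ w, InPattern X m y u₁ u₂ w := by
  have hdU : ∀ {a}, a ∈ U → a ∉ W := fun h => Finset.disjoint_left.1 hUW h
  have hdW : ∀ {a}, a ∈ W → a ∉ U := fun h => Finset.disjoint_right.1 hUW h
  have hZ : 5 ≤ (X.erase y).card := by rw [Finset.card_erase_of_mem hy]; omega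
  have huniq : ∀ a ∈ X.erase y, a ∉ W → ∀ b ∈ W, 0 < m a b → m u₁ u₂ = 1 ∧ a = u₁ ∧ b = u₂ :=
    fun a ha haW b hb hab => cutIn_le_one hWc (hU hu₁) (hW hu₂) (hdU hu₁) hu₂ hu ha (hW hb) haW hb
      hab
  have hno : ∀ a ∈ U, ∀ b ∈ W, m b a = 0 := by
    by_contra! hc
    obtain ⟨a, ha, b, hb, hba⟩ := hc
    have hba := Nat.pos_of_ne_zero hba
    have huniq' : ∀ a' ∈ X.erase y, a' ∉ U → ∀ b' ∈ U, 0 < m a' b' → a' = b ∧ b' = a :=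
      fun a' ha' haU b' hb' hab' => (cutIn_le_one hUc (hW hb) (hU ha) (hdW hb) ha hba ha' (hU hb')
        haU hb' hab').2
    have hall : U ∪ W = X.erase y := by
      by_contra hne
      obtain ⟨c, hc, d, hd, hc', hd', hcd⟩ := h1.exists_arc (Finset.union_subset hU hW)
        ⟨u₁, by simp [hu₁]⟩ hne
      simp only [Finset.mem_union, not_or] at hc' hd'
      rcases hd' with hd' | hd'
      · exact hc'.2 ((huniq' c hc hc'.1 d hd' hcd).1 ▸ hb)
      · exact hc'.1 ((huniq c hc hc'.2 d hd' hcd).2.1 ▸ hu₁)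
    have hprod : U ×ˢ W ⊆ {(u₁, u₂), (a, b)} := by
      rintro ⟨c, d⟩ hcd
      obtain ⟨hc, hd⟩ := Finset.mem_product.1 hcd
      dsimp only at hc hd
      simp only [Finset.mem_insert, Finset.mem_singleton, Prod.mk.injEq]
      rcases hs c (Finset.mem_of_mem_erase (hU hc)) d (Finset.mem_of_mem_erase (hW hd))
        (fun h => hdU hc (h ▸ hd)) with h | h
      · exact .inl (huniq c (hU hc) (hdU hc) d hd h).2
      · exact .inr (huniq' d (hW hd) (hdW hd) c hc h).symm
    have hc1 := (Finset.card_le_card hprod).trans Finset.card_le_two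
    rw [Finset.card_product] at hc1
    rw [← hall, Finset.card_union_of_disjoint hUW] at hZ
    have hUpos := Finset.card_pos.2 ⟨u₁, hu₁⟩
    have hWpos := Finset.card_pos.2 ⟨u₂, hu₂⟩
    nlinarith
  have harc : ∀ a ∈ U, ∀ b ∈ W, a = u₁ ∧ b = u₂ := by
    intro a ha b hb
    refine (huniq a (hU ha) (hdU ha) b hb ?_).2
    have := hno a ha b hb
    have := hs a (Finset.mem_of_mem_erase (hU ha)) b (Finset.mem_of_mem_erase (hW hb))
        (fun h => hdU ha (h ▸ hb))
    omega
  obtain rfl : U = {u₁} := Finset.eq_singleton_iff_unique_mem.2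
    ⟨hu₁, fun a ha => (harc a ha u₂ hu₂).1⟩
  obtain rfl : W = {u₂} := Finset.eq_singleton_iff_unique_mem.2
    ⟨hu₂, fun b hb => (harc u₁ hu₁ b hb).2⟩
  have hu21 : m u₂ u₁ = 0 := hno u₁ (by simp) u₂ (by simp)
  have hne : ∀ a ∈ X, ({a} : Finset V) ≠ X := fun a _ h => by rw [← h] at hX; simp at hX
  rw [Finset.singleton_subset_iff, Finset.mem_erase] at hU hW
  have hyu : ∀ a ∈ X, a ≠ y → cutIn (X.erase y) m {a} ≤ 1 → 0 < m y a := by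
    intro a ha hay hc
    have := h {a} (by simpa) (by simp) (hne a ha)
    simpa using exists_arc_of_cutIn_erase_lt (m := m) hy (U := {a}) (by simp [ha, hay]) (by omega)
  obtain ⟨w, hw, b, hb, hwu, hbu, hwb⟩ := h1.exists_arc (U := {u₁}) (by simp [hU]) (by simp)
    (fun h => by rw [← h] at hZ; simp at hZ)
  simp only [Finset.mem_singleton] at hbu hwu
  subst hbu
  rw [Finset.mem_erase] at hw
  have hwu₂ : w ≠ u₂ := by
    rintro rfl
    omega
  have huniq' : ∀ a ∈ X.erase y, a ≠ b → 0 < m a b → m w b = 1 ∧ a = w := fun a ha hab h =>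
    have := cutIn_le_one hUc (a := w) (by simp [hw]) hb (by simpa) (by simp) hwb ha hb (by simpa)
      (by simp) h
    ⟨this.1, this.2.1⟩
  refine ⟨b, u₂, w, hU.2, hW.2, hw.2, hU.1, hW.1, fun h => hdU (a := b) (by simp) (by simp [h]),
    hw.1, hwu, hwu₂, fun a ha => ⟨fun h => ?_, ?_⟩, fun a ha => ⟨fun h => ?_, ?_⟩,
    (huniq' w (by simp [hw]) hwu hwb).1⟩
  · by_cases hay : a = y
    · exact .inl hay
    · refine .inr (huniq a (by simp [ha, hay]) ?_ u₂ (by simp) h).2.1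
      rw [Finset.mem_singleton]
      rintro rfl
      rw [hl] at h
      omega
  · rintro (rfl | rfl)
    · exact hyu u₂ hW.2 hW.1 hWc
    · exact hu
  · by_cases hay : a = y
    · exact .inl hay
    · refine .inr (huniq' a (by simp [ha, hay]) ?_ h).2
      rintro rfl
      rw [hl] at h
      omega
  · rintro (rfl | rfl)
    · exact hyu b hU.2 hU.1 hUc
    · exact hwb

theorem KConn.exists_inPattern (h : KConn 2 X m) (hs : Semi X m) (hl : ∀ a, m a a = 0)
    (hX : 6 ≤ X.card) (hy : y ∈ X) (h1 : KConn 1 (X.erase y) m) (ht : ¬ TightMeet (X.erase y) m) :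
    ∃ u₁ u₂ w, InPattern X m y u₁ u₂ w := by
  unfold TightMeet at ht
  push Not at ht
  obtain ⟨U, hU, ⟨u, hu⟩, W, hW, ⟨v, hv⟩, hUc, hWc, hUW⟩ := ht
  rcases hs u (Finset.mem_of_mem_erase (hU hu)) v (Finset.mem_of_mem_erase (hW hv))
    (fun h => Finset.disjoint_left.1 hUW hu (h ▸ hv)) with huv | huv
  · exact h.exists_inPattern_of_arc hs hl hX hy h1 hU hW hUc hWc hUW hu hv huv
  · exact h.exists_inPattern_of_arc hs hl hX hy h1 hW hU hWc hUc hUW.symm hv hu huv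

end

/-! ### Closed families of obstructions -/

section

variable {V : Type*} [DecidableEq V] {X Z U K : Finset V} {m : V → V → ℕ} {y u₁ u₂ w : V}

/-- A family `K` of vertices all of which carry a pattern spanned by `K`, in `m` or its reverse. -/
theorem InPattern.false_of_closed (h : KConn 2 X m) (hs : Semi X m)
    (hX : 6 ≤ X.card) (hKX : K ⊆ X)
    (hK : ∀ y ∈ K, (∃ u₁ ∈ K, ∃ u₂ ∈ K, ∃ w, InPattern X m y u₁ u₂ w) ∨
      ∃ u₁ ∈ K, ∃ u₂ ∈ K, ∃ w, InPattern X (rev m) y u₁ u₂ w)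
    (hy : y ∈ K) (hu₁ : u₁ ∈ K) (hu₂ : u₂ ∈ K) (hp : InPattern X m y u₁ u₂ w) : False := by
  have dom : ∀ {z a b : V}, z ∈ X → (∀ c ∈ X, 0 < m c z ↔ c = a ∨ c = b) →
      ∀ v ∈ X, v ≠ z → v ≠ a → v ≠ b → 0 < m z v := fun {z a b} hz hin v hv h1 h2 h3 =>
    (hs z hz v hv h1.symm).resolve_right fun h => ((hin v hv).1 h).elim h2 h3
  have closed : ∀ T ⊆ X, T.Nonempty → T.card ≤ 5 → ∃ a ∈ X, a ∉ T ∧ ∃ b ∈ T, 0 < m a b := by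
    intro T hT hne hc
    obtain ⟨a, ha, b, hb, h1, h2, h3⟩ := (h.anti one_le_two).exists_arc hT hne (by
      rintro rfl
      omega)
    exact ⟨a, ha, h1, b, h2, h3⟩
  have noInOut : ∀ {z a b c d : V}, (∀ v ∈ X, 0 < m v z ↔ v = a ∨ v = b) →
      (∀ v ∈ X, 0 < m z v ↔ v = c ∨ v = d) → z ∈ X → False := by
    intro z a b c d h1 h2 hz
    have : X ⊆ {z, a, b, c, d} := fun v hv => by
      simp only [Finset.mem_insert, Finset.mem_singleton]
      by_cases hvz : v = z
      · exact .inl hvz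
      · have := hs v hv z hz hvz
        rw [h1 v hv, h2 v hv] at this
        tauto
    have := (Finset.card_le_card this).trans Finset.card_le_five
    omega
  have inPat : ∀ {z a b c d : V}, z ∈ K → (∀ v ∈ X, 0 < m v z ↔ v = a ∨ v = b) → a ∈ X →
      (∀ v ∈ X, 0 < m v a ↔ v = c ∨ v = d) → ∃ p ∈ K, ∃ q ∈ K, ∃ r, InPattern X m z p q r := by
    intro z a b c d hz h1 ha h2
    refine (hK z hz).resolve_right ?_
    rintro ⟨p, hp, q, hq, r, hpat⟩
    have e1 : 0 < m p z := (hpat.in₁ z (hKX hz)).2 (.inl rfl)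
    have e2 : 0 < m q z := (hpat.in₂ z (hKX hz)).2 (.inl rfl)
    rw [h1 p (hKX hp)] at e1
    rw [h1 q (hKX hq)] at e2
    have hapq : a = p ∨ a = q := by
      have := hpat.ne₁₂
      by_contra! hc
      exact this ((e1.resolve_left hc.1.symm).trans (e2.resolve_left hc.2.symm).symm)
    rcases hapq with rfl | rfl
    · exact noInOut h2 hpat.in₁ ha
    · exact noInOut h2 hpat.in₂ ha
  have hyX := hKX hy
  obtain ⟨hu₁X, hu₂X, hwX, h1y, h2y, h12, hwy, hw1, hw2, in2, in1, hmul⟩ := hp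
  obtain ⟨p, hpK, q, hqK, r, hpX, hqX, hrX, hp2, hq2, hpq, hr2, hrp, hrq, inq, inp, -⟩ :=
    inPat hu₂ (fun v hv => (in2 v hv).trans or_comm) hu₁X in1
  have closed4 : ∀ a b c d, a ∈ X → b ∈ X → c ∈ X → d ∈ X → (∀ v ∈ X, ∀ z, z = a ∨ z = b ∨ z = c ∨
      z = d → 0 < m v z → v = a ∨ v = b ∨ v = c ∨ v = d) → False := by
    intro a b c d ha hb hc hd hv
    obtain ⟨v, hvX, hvT, z, hz, hvz⟩ := closed {a, b, c, d} (by
      simp [Finset.insert_subset_iff, *]) (by simp) (Finset.card_le_four.trans (by simp))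
    simp only [Finset.mem_insert, Finset.mem_singleton] at hvT hz
    exact hvT (hv v hvX z hz hvz)
  clear noInOut hK hs
  have hpu1 : p ≠ u₁ := by
    rintro rfl
    have := (inp u₂ hu₂X).2 (.inl rfl)
    rw [in1 u₂ hu₂X] at this
    tauto
  have hqu1 : q ≠ u₁ := by
    rintro rfl
    have := (inq u₂ hu₂X).2 (.inl rfl)
    rw [in1 u₂ hu₂X] at this
    tauto
  have hq : q = y ∨ q = w := by
    by_contra! hc
    have := dom hu₁X in1 q hqX hqu1 hc.1 hc.2
    rw [inq u₁ hu₁X] at this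
    clear dom inPat closed closed4 h
    grind
  have hp : p = y ∨ p = w ∨ r = u₁ := by
    by_contra! hc
    have := dom hu₁X in1 p hpX hpu1 hc.1 hc.2.1
    rw [inp u₁ hu₁X] at this
    clear dom inPat closed closed4 h
    grind
  rcases hq with rfl | rfl
  · by_cases hpw : p = w
    · subst hpw
      obtain ⟨p', hpK', q', hqK', r', hpX', hqX', hrX', hp2', hq2', hpq', hr2', hrp', hrq', inq',
        inp', -⟩ := inPat hu₁ in1 hyX inq
      have h1 : 0 < m u₁ p' := (inp' u₁ hu₁X).2 (.inl rfl)
      have h2 : 0 < m u₁ q' := (inq' u₁ hu₁X).2 (.inl rfl)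
      have hq' : q' ≠ u₂ := by
        rintro rfl
        clear dom inPat closed closed4 h
        grind
      have hq'' : 0 < m u₂ q' := dom hu₂X in2 q' hqX' hq'
        (by clear dom inPat closed closed4 h; grind) hq2'
      have : q' = p := by
        by_contra hc
        have := dom hyX inq q' hqX' (by clear dom inPat closed closed4 h; grind) hq' hc
        clear dom inPat closed closed4 h
        grind
      exact closed4 q p u₁ u₂ hyX hpX hu₁X hu₂X (by clear dom inPat closed closed4 h; grind)
    · obtain rfl : r = u₁ := by clear dom inPat closed closed4 h; grind
      obtain ⟨a, haX, haT, b, hb, hab, hne⟩ := h.exists_other hmul.le (U := {q, r, u₂, p})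
        (by simp [Finset.insert_subset_iff, *]) (by simp) (by
          intro hc
          rw [← hc] at hX
          have : ({q, r, u₂, p} : Finset V).card ≤ 4 := Finset.card_le_four
          omega)
      simp only [Finset.mem_insert, Finset.mem_singleton] at haT hb
      clear dom inPat closed closed4 h
      grind
  · by_cases hpy : p = y
    · subst hpy
      obtain ⟨p', hpK', q', hqK', r', hpX', hqX', hrX', hp2', hq2', hpq', hr2', hrp', hrq', inq',
        inp', -⟩ := inPat hu₁ (fun v hv => (in1 v hv).trans or_comm) hqX inq
      have hru : r ≠ u₁ := by
        rintro rfl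
        exact closed4 q p r u₂ hqX hpX hu₁X hu₂X (by clear dom inPat closed closed4 h; grind)
      have h1 : 0 < m u₁ p' := (inp' u₁ hu₁X).2 (.inl rfl)
      have h2 : 0 < m u₁ q' := (inq' u₁ hu₁X).2 (.inl rfl)
      have hq' : q' ≠ u₂ := by
        rintro rfl
        clear dom inPat closed closed4 h
        grind
      have hq'' : 0 < m u₂ q' := dom hu₂X in2 q' hqX' hq'
        (by clear dom inPat closed closed4 h; grind) hq2'
      have : q' = r := by
        by_contra hc
        have := dom hyX inp q' hqX' (by clear dom inPat closed closed4 h; grind) hq' hc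
        clear dom inPat closed closed4 h
        grind
      subst this
      have := dom hqX inq q' hqX' (by clear dom inPat closed closed4 h; grind) hq'
        (by clear dom inPat closed closed4 h; grind)
      clear dom inPat closed closed4 h
      grind
    · obtain rfl : r = u₁ := by clear dom inPat closed closed4 h; grind
      obtain ⟨p', hpK', q', hqK', r', hpX', hqX', hrX', hp2', hq2', hpq', hr2', hrp', hrq', inq',
        inp', -⟩ := inPat hqK inq hu₂X in2
      have hpy' : 0 < m p y := dom hpX inp y hyX (Ne.symm hpy) (Ne.symm h2y) (Ne.symm h1y)
      have hyin : (∀ v ∈ X, 0 < m v y → v = p ∨ v = q) → False := by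
        intro hv
        obtain ⟨v, hvX, hvT, z, hz, hvz⟩ := closed {y, q, r, u₂, p}
          (by simp [Finset.insert_subset_iff, *]) (by simp) Finset.card_le_five
        simp only [Finset.mem_insert, Finset.mem_singleton] at hvT hz
        clear dom inPat closed closed4 h
        grind
      by_cases e1 : q' = r
      · clear dom inPat closed closed4 h; grind
      by_cases e2 : q' = y
      · clear dom inPat closed closed4 h; grind
      by_cases e3 : q' = u₂
      · clear dom inPat closed closed4 h; grind
      have := dom hu₁X in1 q' hqX' e1 e2 hq2'
      have := dom hu₂X in2 q' hqX' e3 e2 e1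
      clear dom inPat closed closed4 h
      grind

end

/-! ### Source components -/

section

variable {V : Type*} [DecidableEq V] {X Z U K : Finset V} {m : V → V → ℕ} {x y u₁ u₂ w : V}

/-- After deleting `x`, no arc enters `K`. -/
structure IsSource (X : Finset V) (m : V → V → ℕ) (x : V) (K : Finset V) : Prop where
  mem : x ∈ X
  subset : K ⊆ X.erase x
  nonempty : K.Nonempty
  ne : K ≠ X.erase x
  noarc : ∀ a ∈ X.erase x, a ∉ K → ∀ b ∈ K, m a b = 0

protected theorem IsSource.rev (h : IsSource X m x K) : IsSource X (rev m) x (X.erase x \ K) where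
  mem := h.mem
  subset := Finset.sdiff_subset
  nonempty := Finset.sdiff_nonempty.2 fun h' => h.ne (h.subset.antisymm h')
  ne h' := by
    obtain ⟨k, hk⟩ := h.nonempty
    have := h.subset hk
    rw [← h'] at this
    exact (Finset.mem_sdiff.1 this).2 hk
  noarc a ha haK b hb := by
    rw [Finset.mem_sdiff] at haK hb
    exact h.noarc b hb.1 hb.2 a (by tauto)

theorem IsSource.of_not_kConn (hx : x ∈ X) (h : ¬ KConn 1 (X.erase x) m) :
    ∃ K, IsSource X m x K := by
  obtain ⟨K, h1, h2, h3, h4⟩ := not_kConn_one h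
  exact ⟨K, hx, h1, h2, h3, h4⟩

theorem KConn.exists_out (h : KConn 1 X m) (hU : U ⊆ X) (hne : U.Nonempty) (hX : U ≠ X) :
    ∃ a ∈ U, ∃ b ∈ X, b ∉ U ∧ 0 < m a b := by
  obtain ⟨a, ha, b, hb, h1, h2, h3⟩ := h.rev.exists_arc hU hne hX
  exact ⟨b, h2, a, ha, h1, h3⟩

theorem IsSource.kConn_erase (h : KConn 2 X m) (hs : Semi X m) (hD : IsSource X m x K)
    (hK2 : 2 ≤ K.card) (hmin : ∀ x' K', IsSource X m x' K' → K.card ≤ K'.card) (hy : y ∈ K) :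
    KConn 1 (X.erase y) m := by
  have hyX := Finset.mem_erase.1 (hD.subset hy)
  by_contra hc
  obtain ⟨U, hU⟩ := IsSource.of_not_kConn hyX.2 hc
  have dom : ∀ a ∈ K, ∀ b ∈ X, b ≠ x → b ∉ K → 0 < m a b := by
    intro a ha b hb hbx hbK
    have haX := Finset.mem_erase.1 (hD.subset ha)
    have := hD.noarc b (by simp [hb, hbx]) hbK a ha
    have := hs a haX.2 b hb (fun h => hbK (h ▸ ha))
    omega
  have hUX : ∀ {v}, v ∈ U → v ≠ y ∧ v ∈ X := fun hv => Finset.mem_erase.1 (hU.subset hv)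
  have noarcU : ∀ a ∈ X, a ≠ y → a ∉ U → ∀ b ∈ U, m a b = 0 := fun a ha hay =>
    hU.noarc a (by simp [ha, hay])
  by_cases hxU : x ∈ U
  · by_cases hW : ∃ k ∈ K, k ≠ y ∧ k ∉ U
    · obtain ⟨k, hk, hky, hkU⟩ := hW
      obtain ⟨z, hz⟩ := hD.rev.nonempty
      obtain ⟨a, ha, b, hb, hbR, hab⟩ := (h.anti one_le_two).exists_out (U := X.erase x \ K)
        (Finset.sdiff_subset.trans (Finset.erase_subset _ _)) ⟨z, hz⟩
        (fun h => by
          have := hD.mem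
          rw [← h] at this
          simp at this)
      simp only [Finset.mem_sdiff, Finset.mem_erase, not_and, not_not] at ha hbR
      have hbx : b = x := by
        by_contra hbx
        have := hD.noarc a (by simp [ha]) ha.2 b (hbR ⟨hbx, hb⟩)
        omega
      have haU : a ∉ U := fun haU => by
        have := noarcU k (Finset.mem_of_mem_erase (hD.subset hk)) hky hkU a haU
        have := dom k hk a ha.1.2 ha.1.1 ha.2
        omega
      have := noarcU a ha.1.2 (fun h => ha.2 (h ▸ hy)) haU x hxU
      rw [hbx] at hab
      omega
    · push Not at hW
      obtain ⟨a, ha, b, hb, hbW, hab⟩ := (h.anti one_le_two).exists_out (U := X.erase y \ U)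
        (Finset.sdiff_subset.trans (Finset.erase_subset _ _)) hU.rev.nonempty
        (fun h => by
          have := hyX.2
          rw [← h] at this
          simp at this)
      simp only [Finset.mem_sdiff, Finset.mem_erase, not_and, not_not] at ha hbW
      have haK : a ∉ K := fun haK => ha.2 (hW a haK ha.1.1)
      have hax : a ≠ x := fun h => ha.2 (h ▸ hxU)
      by_cases hby : b = y
      · have := hD.noarc a (by simp [ha, hax]) haK y hy
        rw [hby] at hab
        omega
      · have := noarcU a ha.1.2 ha.1.1 ha.2 b (hbW ⟨hby, hb⟩)
        omega
  · by_cases hUK : (U ∩ K).Nonempty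
    · have hlt : (U ∩ K).card < K.card := Finset.card_lt_card
        ((Finset.ssubset_iff_of_subset Finset.inter_subset_right).2
          ⟨y, hy, fun h => (hUX (Finset.mem_inter.1 h).1).1 rfl⟩)
      refine hlt.not_ge (hmin y _ ⟨hyX.2, Finset.inter_subset_left.trans hU.subset, hUK, ?_, ?_⟩)
      · intro h
        have : x ∈ X.erase y := by simp [hD.mem, hyX.1.symm]
        rw [← h] at this
        exact hxU (Finset.mem_inter.1 this).1
      · intro a ha haUK b hb
        rw [Finset.mem_erase] at ha
        rw [Finset.mem_inter] at haUK hb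
        by_cases haU : a ∈ U
        · exact hD.noarc a (by simp [ha.2]; rintro rfl; exact hxU haU) (by tauto) b hb.2
        · exact noarcU a ha.2 ha.1 haU b hb.1
    · obtain ⟨u, hu⟩ := hU.nonempty
      obtain ⟨k, hk, hky⟩ := Finset.exists_mem_ne (by omega : 1 < K.card) y
      have hdis : ∀ v ∈ U, v ∉ K := fun v hv hvK => hUK ⟨v, by simp [hv, hvK]⟩
      have := dom k hk u (hUX hu).2 (fun h => hxU (h ▸ hu)) (hdis u hu)
      have := noarcU k (Finset.mem_of_mem_erase (hD.subset hk)) hky (fun h => hdis k h hk) u hu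
      omega

end

/-! ### Existence of an admissible splitting -/

section

variable {V : Type*} [DecidableEq V] {X Z U K : Finset V} {m : V → V → ℕ} {x y u₁ u₂ w : V}

theorem IsSource.false (h : KConn 2 X m) (hs : Semi X m) (hl : ∀ a, m a a = 0) (hX : 6 ≤ X.card)
    (hin : ∀ u ∈ X, ∀ x ∈ X, ∃ v ∈ X, v ≠ x ∧ 0 < m v u)
    (hbad : ∀ y ∈ X, KConn 1 (X.erase y) m →
      (∃ u₁ u₂ w, InPattern X m y u₁ u₂ w) ∨ ∃ u₁ u₂ w, InPattern X (rev m) y u₁ u₂ w)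
    (hD : IsSource X m x K) (hmin : ∀ x' K', IsSource X m x' K' → K.card ≤ K'.card)
    (hmin' : ∀ x' K', IsSource X (rev m) x' K' → K.card ≤ K'.card) : False := by
  set R := X.erase x \ K with hR
  have hKx : ∀ {a}, a ∈ K → a ≠ x := fun ha => (Finset.mem_erase.1 (hD.subset ha)).1
  have hKX : ∀ {a}, a ∈ K → a ∈ X := fun ha => (Finset.mem_erase.1 (hD.subset ha)).2
  have memR : ∀ {a}, a ∈ R ↔ (a ≠ x ∧ a ∈ X) ∧ a ∉ K := by simp [hR]
  have dom : ∀ a ∈ K, ∀ b ∈ R, 0 < m a b := by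
    intro a ha b hb
    rw [memR] at hb
    have := hD.noarc b (by simp [hb]) hb.2 a ha
    have := hs a (hKX ha) b hb.1.2 (fun h => hb.2 (h ▸ ha))
    omega
  have inK : ∀ a ∈ X, ∀ b ∈ K, 0 < m a b → a = x ∨ a ∈ K := by
    intro a ha b hb hab
    by_contra! hc
    have := hD.noarc a (by simp [ha, hc]) hc.2 b hb
    omega
  have outR : ∀ a ∈ R, ∀ b ∈ X, 0 < m a b → b = x ∨ b ∈ R := by
    intro a ha b hb hab
    rw [memR] at ha ⊢
    by_contra! hc
    have := hD.noarc a (by simp [ha]) ha.2 b (by tauto)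
    omega
  have self : ∀ {a b}, 0 < m a b → a ≠ b := by
    rintro a _ hab rfl
    simp [hl] at hab
  have hK2 : 2 ≤ K.card := by
    obtain ⟨k, hk⟩ := hD.nonempty
    obtain ⟨v, hv, hvx, hvk⟩ := hin k (hKX hk) x hD.mem
    exact Finset.one_lt_card.2 ⟨v, (inK v hv k hk hvk).resolve_left hvx, k, hk, self hvk⟩
  have hR2 : 2 ≤ R.card := hK2.trans (hmin' _ _ hD.rev)
  have Rout : ∀ c ∈ R, ∃ a ∈ R, a ≠ c ∧ ∃ b ∈ X, (b = x ∨ b = c) ∧ 0 < m a b := by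
    intro c hc
    have hcc : (R.erase c).Nonempty := Finset.card_pos.1 (by
      rw [Finset.card_erase_of_mem hc]
      omega)
    obtain ⟨a, ha, b, hb, hbR, hab⟩ := (h.anti one_le_two).exists_out (U := R.erase c)
      (fun a ha => (memR.1 (Finset.mem_of_mem_erase ha)).1.2) hcc
      (fun h => by
        have := hD.mem
        rw [← h] at this
        exact (memR.1 (Finset.mem_of_mem_erase this)).1.1 rfl)
    rw [Finset.mem_erase] at ha hbR
    have := outR a ha.2 b hb hab
    exact ⟨a, ha.2, ha.1, b, hb, by tauto, hab⟩
  have Rx : ∃ r ∈ R, 0 < m r x := by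
    obtain ⟨z, hz⟩ := hD.rev.nonempty
    obtain ⟨a, ha, b, hb, hbR, hab⟩ := (h.anti one_le_two).exists_out (U := R)
      (fun a ha => (memR.1 ha).1.2) ⟨z, hz⟩ (fun h => by
        have := hD.mem
        rw [← h] at this
        exact (memR.1 this).1.1 rfl)
    exact ⟨a, ha, (outR a ha b hb hab).resolve_right hbR ▸ hab⟩
  have card_le : ∀ {S : Finset V} {a b : V}, 2 ≤ S.card → (∀ v ∈ S, v = a ∨ v = b) →
      a ∈ S ∧ b ∈ S ∧ a ≠ b := by
    intro S a b hS hab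
    obtain ⟨v, hv, v', hv', hne⟩ := Finset.one_lt_card.1 hS
    rcases hab v hv with rfl | rfl <;> rcases hab v' hv' with rfl | rfl <;>
      simp_all [Ne.symm]
  have noOut : ∀ y ∈ K, ∀ u₁ u₂ w, ¬ InPattern X (rev m) y u₁ u₂ w := by
    intro y hy u₁ u₂ w hp
    have e1 := inK u₁ hp.mem₁ y hy ((hp.in₁ y (hKX hy)).2 (.inl rfl))
    have e2 := inK u₂ hp.mem₂ y hy ((hp.in₂ y (hKX hy)).2 (.inl rfl))
    have : ∃ z ∈ K, ∃ c, ∀ v ∈ X, 0 < m z v → v = y ∨ v = c := by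
      by_cases h1 : u₁ = x
      · exact ⟨u₂, e2.resolve_left fun h2 => hp.ne₁₂ (h1.trans h2.symm), u₁,
          fun v hv => (hp.in₂ v hv).1⟩
      · exact ⟨u₁, e1.resolve_left h1, w, fun v hv => (hp.in₁ v hv).1⟩
    obtain ⟨z, hz, c, hzc⟩ := this
    exact (memR.1 (card_le hR2 fun v hv => hzc v (memR.1 hv).1.2 (dom z hz v hv)).1).2 hy
  have closed : ∀ y ∈ K, ∀ u₁ u₂ w, InPattern X m y u₁ u₂ w → u₁ ∈ K ∧ u₂ ∈ K := by
    intro y hy u₁ u₂ w hp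
    have hu₁R : u₁ ∈ R → w ∈ K := fun hu =>
      (card_le hK2 fun v hv => (hp.in₁ v (hKX hv)).1 (dom v hv u₁ hu)).2.1
    have hu₂R : u₂ ∈ R → u₁ ∈ K := fun hu =>
      (card_le hK2 fun v hv => (hp.in₂ v (hKX hv)).1 (dom v hv u₂ hu)).2.1
    have hyR : y ∉ R := fun h => (memR.1 h).2 hy
    have hu12 : 0 < m u₁ u₂ := (hp.in₂ u₁ hp.mem₁).2 (.inr rfl)
    have hu₂x : u₂ ≠ x := by
      rintro rfl
      obtain ⟨r, hr, hrx⟩ := Rx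
      have hru : r = u₁ := ((hp.in₂ r (memR.1 hr).1.2).1 hrx).resolve_left fun h => hyR (h ▸ hr)
      subst hru
      obtain ⟨a, ha, har, b, hb, hbr, hab⟩ := Rout r hr
      rcases hbr with rfl | rfl
      · rcases (hp.in₂ a (memR.1 ha).1.2).1 hab with rfl | rfl
        · exact hyR ha
        · exact har rfl
      · rcases (hp.in₁ a (memR.1 ha).1.2).1 hab with rfl | rfl
        · exact hyR ha
        · exact (memR.1 ha).2 (hu₁R hr)
    have hu₁x : u₁ ≠ x := by
      rintro rfl
      obtain ⟨a, ha, haR, b, hb, hab, hne⟩ := h.exists_other hp.mul.le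
        (U := X \ R) Finset.sdiff_subset ⟨u₁, by simp [hD.mem, memR]⟩ (fun h => by
          obtain ⟨z, hz⟩ := Finset.card_pos.1 (by omega : 0 < R.card)
          have := (memR.1 hz).1.2
          rw [← h] at this
          exact (Finset.mem_sdiff.1 this).2 hz)
      have haR : a ∈ R := by simpa [ha] using haR
      rw [Finset.mem_sdiff] at hb
      have hbx := (outR a haR b hb.1 hab).resolve_right hb.2
      subst hbx
      rcases (hp.in₁ a ha).1 hab with rfl | rfl
      · exact hyR haR
      · exact hne rfl rfl
    by_cases hu₁K : u₁ ∈ K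
    swap
    · have hu₁' : u₁ ∈ R := memR.2 ⟨⟨hu₁x, hp.mem₁⟩, hu₁K⟩
      exact absurd (hu₂R ((outR u₁ hu₁' u₂ hp.mem₂ hu12).resolve_left hu₂x)) hu₁K
    refine ⟨hu₁K, ?_⟩
    by_contra hu₂K
    have hu₂' : u₂ ∈ R := memR.2 ⟨⟨hu₂x, hp.mem₂⟩, hu₂K⟩
    have hKeq : ∀ v ∈ K, v = y ∨ v = u₁ := fun v hv => (hp.in₂ v (hKX hv)).1 (dom v hv u₂ hu₂')
    have hwu₁ : 0 < m w u₁ := (hp.in₁ w hp.mem_w).2 (.inr rfl)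
    have hyu₁ : 0 < m y u₁ := (hp.in₁ y (hKX hy)).2 (.inl rfl)
    have hwx : w = x := (inK w hp.mem_w u₁ hu₁K hwu₁).resolve_right fun hw => by
      rcases hKeq w hw with h | h
      · exact hp.ne_w h
      · exact hp.ne_w₁ h
    subst hwx
    have hu₁y : 0 < m u₁ y := by
      obtain ⟨v, hv, hvx, hvk⟩ := hin y (hKX hy) w hD.mem
      rcases hKeq v ((inK v hv y hy hvk).resolve_left hvx) with rfl | rfl
      · exact absurd rfl (self hvk)
      · exact hvk
    have hxy : 0 < m w y := by
      obtain ⟨a, ha, haK, b, hb, hab, hne⟩ := h.exists_other hp.mul.le (U := K)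
        (fun a ha => hKX ha) hD.nonempty (fun h => hKx (h ▸ hD.mem) rfl)
      have haw := (inK a ha b hb hab).resolve_right haK
      subst haw
      rcases hKeq b hb with rfl | rfl
      · exact hab
      · exact absurd rfl (hne rfl)
    have hKK : ∀ a ∈ K, ∀ b ∈ K, a ≠ b → 0 < m a b := by
      intro a ha b hb hab
      rcases hKeq a ha with rfl | rfl <;> rcases hKeq b hb with rfl | rfl
      · exact absurd rfl hab
      · exact hyu₁
      · exact hu₁y
      · exact absurd rfl hab
    have hxK : ∀ a ∈ K, 0 < m w a := by
      intro a ha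
      rcases hKeq a ha with rfl | rfl
      · exact hxy
      · exact hwu₁
    have hcon : KConn 1 (X.erase u₂) m := by
      by_contra hc
      obtain ⟨U, hU⟩ := IsSource.of_not_kConn hp.mem₂ hc
      have noarcU : ∀ a ∈ X, a ≠ u₂ → a ∉ U → ∀ b ∈ U, m a b = 0 := fun a ha hay =>
        hU.noarc a (by simp [ha, hay])
      have hUX : ∀ {v}, v ∈ U → v ≠ u₂ ∧ v ∈ X := fun hv => Finset.mem_erase.1 (hU.subset hv)
      have hKu₂ : ∀ {v}, v ∈ K → v ≠ u₂ := fun hv h => hu₂K (h ▸ hv)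
      have hKW : (∃ k ∈ K, k ∉ U) → ∀ k ∈ K, k ∉ U := by
        rintro ⟨k, hk, hkU⟩ k' hk' hk'U
        have := hKK k hk k' hk' (fun h => hkU (h ▸ hk'U))
        have := noarcU k (hKX hk) (hKu₂ hk) hkU k' hk'U
        omega
      have hKWR : (∃ k ∈ K, k ∉ U) → ∀ v ∈ R, v ∉ U := by
        rintro ⟨k, hk, hkU⟩ v hv hvU
        have := dom k hk v hv
        have := noarcU k (hKX hk) (hKu₂ hk) hkU v hvU
        omega
      by_cases hxU : w ∈ U
      · by_cases hW : ∃ k ∈ K, k ∉ U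
        · obtain ⟨a, ha, hau, b, hb, hbx, hab⟩ := Rout u₂ hu₂'
          rcases hbx with rfl | rfl
          · have := noarcU a (memR.1 ha).1.2 hau (hKWR hW a ha) b hxU
            omega
          · rcases hKeq a (by
              rcases (hp.in₂ a (memR.1 ha).1.2).1 hab with rfl | rfl <;> assumption) with rfl | rfl
            · exact hyR ha
            · exact (memR.1 ha).2 hu₁K
        · push Not at hW
          obtain ⟨a, ha, b, hb, hbW, hab⟩ := (h.anti one_le_two).exists_out
            (U := X.erase u₂ \ U) (Finset.sdiff_subset.trans (Finset.erase_subset _ _))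
            hU.rev.nonempty (fun h => by
              have := hp.mem₂
              rw [← h] at this
              simp at this)
          simp only [Finset.mem_sdiff, Finset.mem_erase, not_and, not_not] at ha hbW
          by_cases hbu : b = u₂
          · subst hbu
            rcases (hp.in₂ a ha.1.2).1 hab with rfl | rfl
            · exact ha.2 (hW a hy)
            · exact ha.2 (hW a hu₁K)
          · have := noarcU a ha.1.2 ha.1.1 ha.2 b (hbW ⟨hbu, hb⟩)
            omega
      · have hyU : y ∉ U := fun hyU => by
          have := noarcU w hD.mem hp.ne_w₂ hxU y hyU
          omega
        obtain ⟨v, hv⟩ := hU.nonempty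
        have hvR : v ∈ R := memR.2 ⟨⟨fun h => hxU (h ▸ hv), (hUX hv).2⟩,
          fun hvK => hKW ⟨y, hy, hyU⟩ v hvK hv⟩
        exact hKWR ⟨y, hy, hyU⟩ v hvR hv
    rcases hbad u₂ hp.mem₂ hcon with ⟨p, q, r, hq⟩ | ⟨p, q, r, hq⟩
    · have hpx := (outR u₂ hu₂' p hq.mem₁ ((hq.in₁ u₂ hp.mem₂).2 (.inl rfl))).resolve_right
        fun hpR => hu₂K (card_le hK2 fun v hv => (hq.in₁ v (hKX hv)).1 (dom v hv p hpR)).1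
      have hqx := (outR u₂ hu₂' q hq.mem₂ ((hq.in₂ u₂ hp.mem₂).2 (.inl rfl))).resolve_right
        fun hqR => hu₂K (card_le hK2 fun v hv => (hq.in₂ v (hKX hv)).1 (dom v hv q hqR)).1
      exact hq.ne₁₂ (hpx.trans hqx.symm)
    · have inu₂ : ∀ v ∈ X, 0 < m v u₂ → v ∈ K := fun v hv hvu => by
        rcases (hp.in₂ v hv).1 hvu with rfl | rfl <;> assumption
      have hqK := inu₂ q hq.mem₂ ((hq.in₂ u₂ hp.mem₂).2 (.inl rfl))
      have hpK := inu₂ p hq.mem₁ ((hq.in₁ u₂ hp.mem₂).2 (.inl rfl))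
      have := (card_le hR2 fun v hv => (hq.in₂ v (memR.1 hv).1.2).1 (dom q hqK v hv)).2.1
      exact (memR.1 this).2 hpK
  have hpat : ∀ y ∈ K, ∃ u₁ ∈ K, ∃ u₂ ∈ K, ∃ w, InPattern X m y u₁ u₂ w := by
    intro y hy
    rcases hbad y (hKX hy) (hD.kConn_erase h hs hK2 hmin hy) with ⟨a, b, c, hp⟩ | ⟨a, b, c, hp⟩
    · obtain ⟨h1, h2⟩ := closed y hy a b c hp
      exact ⟨a, h1, b, h2, c, hp⟩
    · exact absurd hp (noOut y hy a b c)
  obtain ⟨y, hy⟩ := hD.nonempty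
  obtain ⟨a, ha, b, hb, c, hp⟩ := hpat y hy
  exact InPattern.false_of_closed h hs hX (fun a ha => hKX ha) (fun y hy => .inl (hpat y hy)) hy ha
    hb hp

theorem KConn.exists_tightMeet (h : KConn 2 X m) (hs : Semi X m) (hl : ∀ a, m a a = 0)
    (hX : 6 ≤ X.card)
    (hin : ∀ u ∈ X, ∀ x ∈ X, ∃ v ∈ X, v ≠ x ∧ 0 < m v u)
    (hout : ∀ u ∈ X, ∀ x ∈ X, ∃ v ∈ X, v ≠ x ∧ 0 < m u v) :
    ∃ y ∈ X, KConn 1 (X.erase y) m ∧ TightMeet (X.erase y) m ∧ TightMeet (X.erase y) (rev m) := by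
  by_contra! hc
  have hbad : ∀ y ∈ X, KConn 1 (X.erase y) m →
      (∃ u₁ u₂ w, InPattern X m y u₁ u₂ w) ∨ ∃ u₁ u₂ w, InPattern X (rev m) y u₁ u₂ w := by
    intro y hy h1
    by_cases ht : TightMeet (X.erase y) m
    · exact .inr (h.rev.exists_inPattern hs.rev hl hX hy h1.rev (hc y hy h1 ht))
    · exact .inl (h.exists_inPattern hs hl hX hy h1 ht)
  by_cases hcut : ∀ y ∈ X, KConn 1 (X.erase y) m
  · have hall := fun y hy => hbad y hy (hcut y hy)
    obtain ⟨y, hy⟩ := Finset.card_pos.1 (by omega : 0 < X.card)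
    have hK : ∀ y ∈ X, (∃ u₁ ∈ X, ∃ u₂ ∈ X, ∃ w, InPattern X m y u₁ u₂ w) ∨
        ∃ u₁ ∈ X, ∃ u₂ ∈ X, ∃ w, InPattern X (rev m) y u₁ u₂ w := fun y hy =>
      (hall y hy).imp (fun ⟨a, b, c, hp⟩ => ⟨a, hp.mem₁, b, hp.mem₂, c, hp⟩)
        fun ⟨a, b, c, hp⟩ => ⟨a, hp.mem₁, b, hp.mem₂, c, hp⟩
    rcases hall y hy with ⟨a, b, c, hp⟩ | ⟨a, b, c, hp⟩
    · exact hp.false_of_closed h hs hX subset_rfl hK hy hp.mem₁ hp.mem₂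
    · exact hp.false_of_closed h.rev hs.rev hX subset_rfl (fun y hy => (hK y hy).symm) hy hp.mem₁
        hp.mem₂
  · push Not at hcut
    obtain ⟨x, hx, hx1⟩ := hcut
    obtain ⟨K, hK⟩ := IsSource.of_not_kConn hx hx1
    classical
    have hex : ∃ n, ∃ x K, (IsSource X m x K ∨ IsSource X (rev m) x K) ∧ K.card = n :=
      ⟨_, x, K, .inl hK, rfl⟩
    obtain ⟨x, K, hK, hn⟩ := Nat.find_spec hex
    have hmin : ∀ x' K', IsSource X m x' K' → K.card ≤ K'.card := fun x' K' h' =>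
      hn.trans_le (Nat.find_min' hex ⟨x', K', .inl h', rfl⟩)
    have hmin' : ∀ x' K', IsSource X (rev m) x' K' → K.card ≤ K'.card := fun x' K' h' =>
      hn.trans_le (Nat.find_min' hex ⟨x', K', .inr h', rfl⟩)
    rcases hK with hK | hK
    · exact hK.false h hs hl hX hin hbad hmin hmin'
    · exact hK.false h.rev hs.rev hl hX hout (fun y hy h1 => (hbad y hy h1.rev).symm) hmin' hmin

end

/-! ### Kernel searches on few vertices -/

section

/-- A right fold, defined by the recursor so that the kernel evaluates it quickly. -/
noncomputable def fold {α β : Type} (f : α → β → β) (b : β) (l : List α) : β :=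
  List.rec b (fun a _ r => f a r) l

theorem fold_eq {α β : Type} (f : α → β → β) (b : β) (l : List α) : fold f b l = l.foldr f b := by
  induction l with
  | nil => rfl
  | cons a l ih => rw [List.foldr_cons, ← ih]; rfl

/-- The indicator of the bit set `L` at `e`. -/
def bit (L e : ℕ) : ℕ := Nat.mod (Nat.div L (Nat.pow 2 e)) 2

theorem bit_eq (L e : ℕ) : bit L e = (L.testBit e).toNat := (Nat.toNat_testBit L e).symm

/-- The multiplicity of `e` recorded by the bit sets `L₁` and `L₂`. -/
def mult (L₁ L₂ e : ℕ) : ℕ := Nat.add (bit L₁ e) (bit L₂ e)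

/-- The bit set with the elements of `es`. -/
def mask (es : List ℕ) : ℕ := es.foldr (fun e x => 2 ^ e ||| x) 0

/-- Branch over the elements of `es`: raise the multiplicity recorded by the bit sets `L₁`, `L₂`
of one of them that is not in `F`, where the elements before it are added to `F`. -/
noncomputable def branch (f : ℕ → ℕ → ℕ → Bool) (es : List ℕ) (L₁ L₂ : ℕ) : ℕ → Bool :=
  fold (fun e g F =>
    (Nat.ble 1 (bit F e) ||
      bif Nat.ble 1 (bit L₁ e) then f L₁ (Nat.lor L₂ (Nat.pow 2 e)) F
        else f (Nat.lor L₁ (Nat.pow 2 e)) L₂ F) &&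
      g (Nat.lor F (Nat.pow 2 e))) (fun _ => true) es

/-- A fast sufficient condition for a constraint to hold. -/
def fulfilled (k x y : ℕ) : Bool :=
  Nat.ble 1 y || bif Nat.ble k 1 then Nat.ble 1 x else Nat.ble 1 (Nat.land x (Nat.pred x))

/-- Search through the ways to satisfy the constraints `(k, es)`, that the multiplicities of the
elements of `es` sum to at least `k`, and check `chk` for the bit sets found. -/
noncomputable def search (chk : ℕ → ℕ → Bool) (l : List (ℕ × List ℕ)) : ℕ → ℕ → ℕ → Bool :=
  fold (fun p g L₁ L₂ F =>
    bif fulfilled p.1 (Nat.land L₁ (mask p.2)) (Nat.land L₂ (mask p.2)) ||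
      Nat.ble p.1 (fold (fun e => Nat.add (mult L₁ L₂ e)) 0 p.2) then g L₁ L₂ F
    else branch g p.2 L₁ L₂ F) (fun L₁ L₂ _ => chk L₁ L₂) l

theorem branch_cons (f : ℕ → ℕ → ℕ → Bool) (e : ℕ) (es : List ℕ) (L₁ L₂ F : ℕ) :
    branch f (e :: es) L₁ L₂ F = ((Nat.ble 1 (bit F e) ||
      bif Nat.ble 1 (bit L₁ e) then f L₁ (Nat.lor L₂ (Nat.pow 2 e)) F
        else f (Nat.lor L₁ (Nat.pow 2 e)) L₂ F) &&
      branch f es L₁ L₂ (Nat.lor F (Nat.pow 2 e))) := rfl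

theorem search_cons (chk : ℕ → ℕ → Bool) (k : ℕ) (es : List ℕ) (l : List (ℕ × List ℕ))
    (L₁ L₂ F : ℕ) : search chk ((k, es) :: l) L₁ L₂ F =
      bif fulfilled k (Nat.land L₁ (mask es)) (Nat.land L₂ (mask es)) ||
        Nat.ble k (fold (fun e => Nat.add (mult L₁ L₂ e)) 0 es) then search chk l L₁ L₂ F
      else branch (search chk l) es L₁ L₂ F := rfl

theorem ble_bit {L e : ℕ} : Nat.ble 1 (bit L e) = L.testBit e := by
  rw [bit_eq]
  cases L.testBit e <;> rfl

theorem testBit_lor_pow {L e x : ℕ} :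
    (Nat.lor L (Nat.pow 2 e)).testBit x = (L.testBit x || decide (e = x)) := by
  rw [← Nat.testBit_two_pow, ← Nat.testBit_or]
  rfl

theorem mult_eq (L₁ L₂ e : ℕ) : mult L₁ L₂ e = (L₁.testBit e).toNat + (L₂.testBit e).toNat := by
  rw [← bit_eq, ← bit_eq]
  rfl

theorem fold_mult (L₁ L₂ : ℕ) (es : List ℕ) :
    fold (fun e => Nat.add (mult L₁ L₂ e)) 0 es = (es.map (mult L₁ L₂)).sum := by
  rw [fold_eq]
  exact List.foldr_map.symm

theorem mult_or_right {L₁ L₂ e : ℕ} (h : L₁.testBit e = true) (x : ℕ) :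
    mult L₁ (Nat.lor L₂ (Nat.pow 2 e)) x = max (mult L₁ L₂ x) (if x = e then 2 else 0) := by
  simp only [mult_eq]
  rw [testBit_lor_pow]
  by_cases hx : x = e
  · subst hx
    cases h2 : L₂.testBit x <;> simp [h]
  · simp [hx, Ne.symm hx]

theorem mult_or_left {L₁ L₂ e : ℕ} (h : L₁.testBit e = false) (x : ℕ) :
    mult (Nat.lor L₁ (Nat.pow 2 e)) L₂ x = mult L₁ L₂ x + if x = e then 1 else 0 := by
  simp only [mult_eq]
  rw [testBit_lor_pow]
  by_cases hx : x = e
  · subst hx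
    simp [h]
    omega
  · simp [hx, Ne.symm hx]

theorem branch_sound {c : ℕ → ℕ} {f : ℕ → ℕ → ℕ → Bool} {P : Prop}
    (hf : ∀ L₁ L₂ F, (∀ e, mult L₁ L₂ e ≤ c e) → (∀ e, F.testBit e = true → c e ≤ mult L₁ L₂ e) →
      f L₁ L₂ F = true → P) {es : List ℕ} {L₁ L₂ F : ℕ} (hL : ∀ e, mult L₁ L₂ e ≤ c e)
    (hF : ∀ e, F.testBit e = true → c e ≤ mult L₁ L₂ e)
    (hes : (es.map (mult L₁ L₂)).sum < (es.map c).sum) (h : branch f es L₁ L₂ F = true) : P := by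
  induction es generalizing F with
  | nil => simp at hes
  | cons e es ih =>
    simp only [branch_cons, ble_bit, Bool.and_eq_true, Bool.or_eq_true] at h
    simp only [List.map_cons, List.sum_cons] at hes
    obtain ⟨h1, h2⟩ := h
    by_cases he : c e ≤ mult L₁ L₂ e
    · refine ih (fun x hx => ?_) (by omega) h2
      rw [testBit_lor_pow, Bool.or_eq_true, decide_eq_true_iff] at hx
      rcases hx with hx | rfl
      exacts [hF x hx, he]
    · have h3 : ¬ F.testBit e = true := fun h => he (hF e h)
      replace h1 := h1.resolve_left h3
      cases h4 : L₁.testBit e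
      · rw [h4, cond_false] at h1
        refine hf _ _ _ (fun x => ?_) (fun x hx => ?_) h1 <;> rw [mult_or_left h4]
        · have := hL x
          split_ifs with hx
          · subst hx
            omega
          · omega
        · have := hF x hx
          omega
      · rw [h4, cond_true] at h1
        have h5 : 1 ≤ mult L₁ L₂ e := by simp [mult_eq, h4]
        refine hf _ _ _ (fun x => ?_) (fun x hx => ?_) h1 <;> rw [mult_or_right h4]
        · have := hL x
          split_ifs with hx
          · subst hx
            omega
          · omega
        · have := hF x hx
          omega

theorem search_sound {c : ℕ → ℕ} {chk : ℕ → ℕ → Bool} {l : List (ℕ × List ℕ)}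
    (hl : ∀ p ∈ l, p.1 ≤ (p.2.map c).sum) {L₁ L₂ F : ℕ} (hL : ∀ e, mult L₁ L₂ e ≤ c e)
    (hF : ∀ e, F.testBit e = true → c e ≤ mult L₁ L₂ e) (h : search chk l L₁ L₂ F = true) :
    ∃ L₁ L₂, (∀ e, mult L₁ L₂ e ≤ c e) ∧ chk L₁ L₂ = true := by
  induction l generalizing L₁ L₂ F with
  | nil => exact ⟨L₁, L₂, hL, h⟩
  | cons p l ih =>
    obtain ⟨k, es⟩ := p
    rw [search_cons, fold_mult] at h
    rw [List.forall_mem_cons] at hl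
    generalize fulfilled k _ _ = b at h
    cases hk : b || Nat.ble k (es.map (mult L₁ L₂)).sum
    · rw [hk, cond_false] at h
      refine branch_sound (fun _ _ _ => ih hl.2) hL hF ?_ h
      have : ¬ k ≤ (es.map (mult L₁ L₂)).sum := fun h => by
        simp [Nat.ble_eq_true_of_le h] at hk
      have := hl.1
      dsimp only at this
      omega
    · rw [hk, cond_true] at h
      exact ih hl.2 hL hF h

/-- The codes of the arcs with vertices below `n` that enter `U`. -/
def cutArcs (n : ℕ) (U : Finset ℕ) : List ℕ :=
  (List.range n).flatMap fun i => (List.range n).flatMap fun j =>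
    if i ∉ U ∧ j ∈ U then [5 * i + j] else []

/-- The graph with arcs coded by the bit set `L` is strong, where `cs` lists its cuts. -/
noncomputable def isStrong (cs : List (List ℕ)) (L : ℕ) : Bool :=
  fold (fun es b => Nat.ble 1 (Nat.land L (mask es)) && b) true cs

/-- One of the bit sets in `T` is a strong subgraph of `L₁` whose removal leaves a strong graph. -/
noncomputable def isDec (cs : List (List ℕ)) (T : List ℕ) (L₁ L₂ : ℕ) : Bool :=
  fold (fun h b => (Nat.beq (Nat.land h L₁) h && isStrong cs h &&
    isStrong cs (Nat.lor (Nat.xor L₁ h) L₂)) || b) false T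

theorem isStrong_iff {cs : List (List ℕ)} {L : ℕ} :
    isStrong cs L = true ↔ ∀ es ∈ cs, Nat.ble 1 (Nat.land L (mask es)) = true := by
  rw [isStrong, fold_eq]
  induction cs <;> simp_all

theorem isDec_iff {cs : List (List ℕ)} {T : List ℕ} {L₁ L₂ : ℕ} :
    isDec cs T L₁ L₂ = true ↔ ∃ h ∈ T, Nat.beq (Nat.land h L₁) h = true ∧ isStrong cs h = true ∧
      isStrong cs (Nat.lor (Nat.xor L₁ h) L₂) = true := by
  rw [isDec, fold_eq]
  induction T <;> simp_all [and_assoc]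

/-- `cs` lists the cuts of graphs with vertices below `n`. -/
def IsCuts (n : ℕ) (cs : List (List ℕ)) : Prop :=
  (∀ U ⊆ Finset.range n, U.Nonempty → U ≠ Finset.range n → cutArcs n U ∈ cs) ∧
  ∀ es ∈ cs, ∃ U ⊆ Finset.range n, U.Nonempty ∧ U ≠ Finset.range n ∧ cutArcs n U = es

instance (n : ℕ) (cs : List (List ℕ)) : Decidable (IsCuts n cs) :=
  decidable_of_iff ((∀ U ∈ (Finset.range n).powerset, U.Nonempty → U ≠ Finset.range n →
    cutArcs n U ∈ cs) ∧ ∀ es ∈ cs, ∃ U ∈ (Finset.range n).powerset, U.Nonempty ∧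
    U ≠ Finset.range n ∧ cutArcs n U = es) (by simp only [Finset.mem_powerset, IsCuts])

theorem cutIn_range (n : ℕ) (c : ℕ → ℕ) (U : Finset ℕ) :
    cutIn (Finset.range n) (fun i j => c (5 * i + j)) U = ((cutArcs n U).map c).sum := by
  unfold cutIn cutArcs
  have key : ∀ (f : ℕ → List ℕ) (l : List ℕ),
      ((l.flatMap f).map c).sum = (l.map fun i => ((f i).map c).sum).sum := fun f l => by
    induction l with
    | nil => rfl
    | cons a l ih => simp [ih]
  have key' : ∀ f : ℕ → ℕ, ∑ i ∈ Finset.range n, f i = ((List.range n).map f).sum := fun _ => rfl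
  simp only [key, key']
  refine congrArg _ (List.map_congr_left fun i _ => congrArg _ (List.map_congr_left fun j _ => ?_))
  split_ifs <;> simp

theorem testBit_mask {es : List ℕ} {e : ℕ} : (mask es).testBit e = true ↔ e ∈ es := by
  induction es with
  | nil => simp [mask]
  | cons a es ih =>
    rw [mask, List.foldr_cons, Nat.testBit_or, Nat.testBit_two_pow, Bool.or_eq_true, ← mask, ih]
    simp [eq_comm]

theorem isStrong_sound {n : ℕ} {cs : List (List ℕ)} (hcs : IsCuts n cs) {L : ℕ}
    (h : isStrong cs L = true) :
    KConn 1 (Finset.range n) fun i j => (L.testBit (5 * i + j)).toNat := by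
  intro U hU hne hUn
  rw [cutIn_range n fun e => (L.testBit e).toNat]
  rw [isStrong_iff] at h
  obtain ⟨e, he⟩ := Nat.exists_testBit_of_ne_zero
    (Nat.pos_iff_ne_zero.1 (Nat.le_of_ble_eq_true (h _ (hcs.1 U hU hne hUn))))
  rw [Nat.land_eq, Nat.testBit_and, Bool.and_eq_true, testBit_mask] at he
  obtain ⟨h, he⟩ := he
  refine le_trans ?_ (List.single_le_sum (by simp) _ (List.mem_map_of_mem he))
  simp [h]

theorem isDec_sound {n : ℕ} {cs : List (List ℕ)} (hcs : IsCuts n cs) {T : List ℕ} {L₁ L₂ : ℕ}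
    (h : isDec cs T L₁ L₂ = true) {c : ℕ → ℕ} (hL : ∀ e, mult L₁ L₂ e ≤ c e) :
    Dec (Finset.range n) fun i j => c (5 * i + j) := by
  rw [isDec_iff] at h
  obtain ⟨h, -, h1, h2, h3⟩ := h
  refine ⟨_, _, fun i _ j _ => (le_trans ?_ (hL _)), isStrong_sound hcs h2, isStrong_sound hcs h3⟩
  have := congrArg (fun x => x.testBit (5 * i + j)) (Nat.eq_of_beq_eq_true h1)
  simp only [Nat.land_eq, Nat.testBit_and] at this
  simp only [mult_eq, Nat.lor_eq, Nat.xor_eq, Nat.testBit_or, Nat.testBit_xor]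
  revert this
  cases h.testBit (5 * i + j) <;> cases L₁.testBit (5 * i + j) <;>
    cases L₂.testBit (5 * i + j) <;> simp

/-- The cuts of graphs on three vertices. -/
def cuts₃ : List (List ℕ) := 
  [[5, 10], [1, 11], [10, 11], [2, 7], [5, 7], [1, 2]]

/-- The cuts of graphs on four vertices. -/
def cuts₄ : List (List ℕ) := 
  [[5, 10, 15], [1, 11, 16], [2, 7, 17], [15, 16, 17], [3, 8, 13], [10, 11, 13], [5, 7, 8], [1, 2,
  3], [10, 11, 15, 16], [5, 7, 15, 17], [1, 2, 16, 17], [5, 8, 10, 13], [1, 3, 11, 13], [2, 3, 7,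
  8]]

/-- The cuts of graphs on five vertices. -/
def cuts₅ : List (List ℕ) := 
  [[5, 10, 15, 20], [1, 11, 16, 21], [2, 7, 17, 22], [3, 8, 13, 23], [20, 21, 22, 23], [4, 9, 14,
  19], [15, 16, 17, 19], [10, 11, 13, 14], [5, 7, 8, 9], [1, 2, 3, 4], [10, 11, 15, 16, 20, 21],
  [5, 7, 15, 17, 20, 22], [1, 2, 16, 17, 21, 22], [15, 16, 17, 20, 21, 22], [5, 8, 10, 13, 20,
  23], [1, 3, 11, 13, 21, 23], [10, 11, 13, 20, 21, 23], [2, 3, 7, 8, 22, 23], [5, 7, 8, 20, 22,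
  23], [1, 2, 3, 21, 22, 23], [5, 9, 10, 14, 15, 19], [1, 4, 11, 14, 16, 19], [10, 11, 14, 15, 16,
  19], [2, 4, 7, 9, 17, 19], [5, 7, 9, 15, 17, 19], [1, 2, 4, 16, 17, 19], [3, 4, 8, 9, 13, 14],
  [5, 8, 9, 10, 13, 14], [1, 3, 4, 11, 13, 14], [2, 3, 4, 7, 8, 9]]

theorem isCuts₃ : IsCuts 3 cuts₃ := by decide +kernel

theorem isCuts₄ : IsCuts 4 cuts₄ := by decide +kernel

theorem isCuts₅ : IsCuts 5 cuts₅ := by decide +kernel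

/-- The pairs of opposite arcs of the graph on the vertices below `n`. -/
def pairs (n : ℕ) : List (List ℕ) :=
  (List.range n).flatMap fun j => (List.range j).map fun i => [5 * i + j, 5 * j + i]

/-- The constraints satisfied by semicomplete 2-arc-strong graphs. -/
def constraints (n : ℕ) (cs : List (List ℕ)) : List (ℕ × List ℕ) :=
  (pairs n).map (1, ·) ++ cs.flatMap fun es => [(2, es), (2, es)]

/-- Arc-disjoint from some strong subgraph in many graphs on five vertices. -/
def templates : List ℕ := 
  [1581186, 8437890, 1196290, 4719874, 4235778, 8521218, 1575172, 8423940, 1122820, 2629668,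
  2146564, 8470564, 1130632, 4261384, 1182216, 2244648, 2622600, 4720680, 2138256, 2229520,
  4229392, 4268080, 8455312, 8521776, 2630786, 1589634, 4721928, 4235410, 1581318, 4720138,
  4327170, 2662530, 8438022, 8430210, 2629800, 3686660, 12650000, 1589386, 8471688, 4759682,
  4228866, 12617218, 2163864, 6817032, 6816808, 4301328]

/-- The arcs of the path `0, 1, …, n - 1`. -/
def path (n : ℕ) : List ℕ := (List.range (n - 1)).map fun i => 5 * i + (i + 1)

theorem search₃ :
    search (isDec cuts₃ [1154, 2084]) (constraints 3 cuts₃) (mask (path 3)) 0 0 = true := by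
  decide +kernel

/-- A graph on four vertices without strong arc decomposition. -/
def arcs₄ : List ℕ := [1, 2, 7, 8, 10, 13, 15, 16]

/-- Another labelling of the graph `arcs₄`. -/
def arcs₄' : List ℕ := [1, 3, 5, 7, 10, 13, 16, 17]

theorem search₄ :
    search (fun L₁ L₂ => isDec cuts₄ [41090, 132354, 35076, 73764, 66696, 133160] L₁ L₂ ||
      Nat.beq (Nat.land (mask arcs₄) L₁) (mask arcs₄) ||
      Nat.beq (Nat.land (mask arcs₄') L₁) (mask arcs₄'))
    (constraints 4 cuts₄) (mask (path 4)) 0 0 = true := by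
  decide +kernel

theorem search₅ :
    search (isDec cuts₅ templates) (constraints 5 cuts₅) (mask (path 5)) 0 0 = true := by
  decide +kernel

/-- The constraints on a supergraph of `arcs₄` with a split off vertex `4`. -/
def constraints₄ : List (List ℕ) :=
  ((arcs₄.product arcs₄).filter fun p =>
    p.1 < p.2 && (p.1 / 5 == p.2 / 5 || p.1 % 5 == p.2 % 5)).map
    (fun p => [p.1, p.2]) ++
  ((arcs₄.product (arcs₄.product arcs₄)).filter fun p => p.1 < p.2.1 && p.2.1 < p.2.2).map
    (fun p => [p.1, p.2.1, p.2.2]) ++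
  arcs₄.flatMap (fun e => [[e, 5 * (e / 5) + 4], [e, 20 + e % 5]]) ++
  (List.range 4).flatMap fun j => (List.range j).flatMap fun i =>
    [[5 * i + 4, 5 * j + 4], [20 + i, 20 + j]]

theorem search₄' : search (isDec cuts₅ templates) (constraints₄.map (1, ·)) 0 0 0 = true := by
  decide +kernel

end

/-! ### Decompositions on three, four and five vertices -/

section

section Path

variable {α : Type*} {R : α → α → Prop}

theorem exists_perm_cons_isChain {x : α} (l : List α) (a : α) (h : (a :: l).IsChain R)
    (hax : R a x) (hx : ∀ b ∈ l, R b x ∨ R x b) :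
    ∃ l' : List α, l'.Perm (x :: l) ∧ (a :: l').IsChain R := by
  induction l generalizing a with
  | nil => exact ⟨[x], .refl _, by simpa⟩
  | cons b l ih =>
    rw [List.isChain_cons_cons] at h
    by_cases hb : R b x
    · obtain ⟨l', h1, h2⟩ := ih b h.2 hb fun c hc => hx c (List.mem_cons_of_mem _ hc)
      exact ⟨b :: l', (h1.cons b).trans (.swap _ _ _), by simpa [h.1] using h2⟩
    · refine ⟨x :: b :: l, .refl _, ?_⟩
      have := (hx b List.mem_cons_self).resolve_left hb
      simp only [List.isChain_cons_cons]
      exact ⟨hax, this, h.2⟩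

variable [DecidableEq α]

theorem Semi.exists_isChain {X : Finset α} {m : α → α → ℕ} (h : Semi X m) :
    ∃ l : List α, l.Nodup ∧ l.toFinset = X ∧ l.IsChain fun a b => 0 < m a b := by
  induction X using Finset.induction_on with
  | empty => exact ⟨[], by simp⟩
  | insert x X hx ih =>
    obtain ⟨l, h1, h2, h3⟩ := ih fun a ha b hb =>
      h a (Finset.mem_insert_of_mem ha) b (Finset.mem_insert_of_mem hb)
    suffices ∃ l' : List α, l'.Perm (x :: l) ∧ l'.IsChain fun a b => 0 < m a b by
      obtain ⟨l', h4, h5⟩ := this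
      refine ⟨l', h4.nodup_iff.2 (List.nodup_cons.2 ⟨?_, h1⟩), ?_, h5⟩
      · rwa [← List.mem_toFinset, h2]
      · rw [List.toFinset_eq_of_perm _ _ h4, List.toFinset_cons, h2]
    have hxl : ∀ b ∈ l, 0 < m b x ∨ 0 < m x b := fun b hb => by
      rw [← List.mem_toFinset, h2] at hb
      exact h b (Finset.mem_insert_of_mem hb) x (Finset.mem_insert_self _ _)
        (fun h => hx (h ▸ hb))
    cases l with
    | nil => exact ⟨[x], .refl _, by simp⟩
    | cons a l =>
      by_cases ha : 0 < m a x
      · obtain ⟨l', h4, h5⟩ := exists_perm_cons_isChain l a h3 ha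
          fun b hb => hxl b (List.mem_cons_of_mem _ hb)
        exact ⟨a :: l', (h4.cons a).trans (.swap _ _ _), h5⟩
      · refine ⟨x :: a :: l, .refl _, List.isChain_cons_cons.2 ⟨?_, h3⟩⟩
        exact (hxl a List.mem_cons_self).resolve_left ha

theorem Semi.exists_path {X : Finset α} {m : α → α → ℕ} (h : Semi X m) (hX : X.Nonempty) :
    ∃ f : ℕ → α, Set.InjOn f (Finset.range X.card) ∧ (Finset.range X.card).image f = X ∧
      ∀ i, i + 1 < X.card → 0 < m (f i) (f (i + 1)) := by
  obtain ⟨l, h1, rfl, h3⟩ := h.exists_isChain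
  obtain ⟨x, -⟩ := hX
  rw [List.toFinset_card_of_nodup h1]
  refine ⟨fun i => l.getD i x, ?_, ?_, fun i hi => ?_⟩
  · intro i hi j hj hij
    simp only [Finset.coe_range, Set.mem_Iio] at hi hj
    simp only [List.getD_eq_getElem _ _ hi, List.getD_eq_getElem _ _ hj] at hij
    exact (h1.getElem_inj_iff).1 hij
  · ext a
    simp only [Finset.mem_image, Finset.mem_range, List.mem_toFinset, List.mem_iff_getElem]
    constructor
    · rintro ⟨i, hi, rfl⟩
      exact ⟨i, hi, (List.getD_eq_getElem _ _ hi).symm⟩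
    · rintro ⟨i, hi, rfl⟩
      exact ⟨i, hi, List.getD_eq_getElem _ _ hi⟩
  · simp only [List.getD_eq_getElem _ _ hi, List.getD_eq_getElem _ _ (Nat.lt_of_succ_lt hi)]
    exact List.isChain_iff_getElem.1 h3 i hi

end Path

variable {V : Type*} [DecidableEq V] {X : Finset V} {m : V → V → ℕ} {f : ℕ → V} {n : ℕ}

theorem cutIn_image (hf : Set.InjOn f (Finset.range n)) (m : V → V → ℕ) (U : Finset V) :
    cutIn ((Finset.range n).image f) m U =
      cutIn (Finset.range n) (fun i j => m (f i) (f j))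
        ((Finset.range n).filter fun i => f i ∈ U) := by
  unfold cutIn
  rw [Finset.sum_image hf]
  refine Finset.sum_congr rfl fun i hi => ?_
  rw [Finset.sum_image hf]
  refine Finset.sum_congr rfl fun j hj => ?_
  simp only [Finset.mem_range] at hi hj
  simp [hi, hj]

theorem KConn.of_image {k : ℕ} (hf : Set.InjOn f (Finset.range n))
    (h : KConn k ((Finset.range n).image f) m) :
    KConn k (Finset.range n) fun i j => m (f i) (f j) := by
  intro U hU hne hUn
  have hUf : (Finset.range n).filter (fun i => f i ∈ U.image f) = U := by
    ext i
    simp only [Finset.mem_filter, Finset.mem_image]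
    constructor
    · rintro ⟨hi, j, hj, hij⟩
      exact hf (hU hj) hi hij ▸ hj
    · exact fun hi => ⟨hU hi, i, hi, rfl⟩
  have := h (U.image f) (Finset.image_subset_image hU) (hne.image f) fun he => hUn ?_
  · rwa [cutIn_image hf, hUf] at this
  · rw [← hUf, he, Finset.filter_true_of_mem]
    exact fun i hi => Finset.mem_image_of_mem _ hi

theorem KConn.image {k : ℕ} (hf : Set.InjOn f (Finset.range n))
    (h : KConn k (Finset.range n) fun i j => m (f i) (f j)) :
    KConn k ((Finset.range n).image f) m := by
  intro U hU hne hUn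
  rw [cutIn_image hf]
  refine h _ (Finset.filter_subset _ _) ?_ fun he => hUn ?_
  · obtain ⟨u, hu⟩ := hne
    obtain ⟨i, hi, rfl⟩ := Finset.mem_image.1 (hU hu)
    exact ⟨i, Finset.mem_filter.2 ⟨hi, hu⟩⟩
  · refine hU.antisymm fun a ha => ?_
    obtain ⟨i, hi, rfl⟩ := Finset.mem_image.1 ha
    rw [← he] at hi
    exact (Finset.mem_filter.1 hi).2

theorem Dec.image (hf : Set.InjOn f (Finset.range n))
    (h : Dec (Finset.range n) fun i j => m (f i) (f j)) : Dec ((Finset.range n).image f) m := by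
  obtain ⟨p, q, h1, h2, h3⟩ := h
  have key : ∀ r : ℕ → ℕ → ℕ, KConn 1 (Finset.range n) r → KConn 1 ((Finset.range n).image f)
      fun a b => r (Function.invFunOn f (Finset.range n) a)
        (Function.invFunOn f (Finset.range n) b) := fun r hr => by
    refine KConn.image hf fun U hU hne hUn => (hr U hU hne hUn).trans (cutIn_mono ?_)
    intro i hi j hj
    rw [hf.leftInvOn_invFunOn hi, hf.leftInvOn_invFunOn hj]
  refine ⟨_, _, ?_, key p h2, key q h3⟩
  simp only [Finset.forall_mem_image]
  intro i hi j hj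
  rw [hf.leftInvOn_invFunOn hi, hf.leftInvOn_invFunOn hj]
  exact h1 i hi j hj

theorem le_sum_of_mem_constraints {cs : List (List ℕ)} (hcs : IsCuts n cs) {c : ℕ → ℕ}
    (hs : Semi (Finset.range n) fun i j => c (5 * i + j))
    (h : KConn 2 (Finset.range n) fun i j => c (5 * i + j)) {p : ℕ × List ℕ}
    (hp : p ∈ constraints n cs) : p.1 ≤ (p.2.map c).sum := by
  simp only [constraints, pairs, List.mem_append, List.mem_map, List.mem_flatMap, List.mem_range,
    List.mem_cons, List.not_mem_nil, or_false, or_self] at hp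
  obtain ⟨-, ⟨j, hj, i, hi, rfl⟩, rfl⟩ | ⟨es, hes, rfl⟩ := hp
  · have := hs i (by simp; omega) j (by simp; omega) hi.ne
    simp only [List.map_cons, List.map_nil, List.sum_cons, List.sum_nil] at this ⊢
    omega
  · obtain ⟨U, h1, h2, h3, rfl⟩ := hcs.2 es hes
    rw [← cutIn_range]
    exact h U h1 h2 h3

theorem exists_of_search (hs : Semi X m) (h : KConn 2 X m) (hX : X.card = n) (hn : 0 < n)
    (hn' : n ≤ 5) {cs : List (List ℕ)} (hcs : IsCuts n cs) {chk : ℕ → ℕ → Bool}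
    (hsearch : search chk (constraints n cs) (mask (path n)) 0 0 = true) :
    ∃ f : ℕ → V, Set.InjOn f (Finset.range n) ∧ (Finset.range n).image f = X ∧
      ∃ L₁ L₂, (∀ e, mult L₁ L₂ e ≤ m (f (e / 5)) (f (e % 5))) ∧ chk L₁ L₂ = true := by
  subst hX
  obtain ⟨f, h1, h2, h3⟩ := hs.exists_path (Finset.card_pos.1 hn)
  refine ⟨f, h1, h2, search_sound (fun p hp => ?_) (fun e => ?_) (by simp) hsearch⟩
  · have hc : ∀ i ∈ Finset.range X.card, ∀ j ∈ Finset.range X.card,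
        m (f ((5 * i + j) / 5)) (f ((5 * i + j) % 5)) = m (f i) (f j) := fun i _ j hj => by
      rw [Finset.mem_range] at hj
      rw [show (5 * i + j) / 5 = i by omega, show (5 * i + j) % 5 = j by omega]
    refine le_sum_of_mem_constraints hcs (fun i hi j hj hij => ?_) ?_ hp
    · beta_reduce
      rw [hc i hi j hj, hc j hj i hi]
      refine hs _ ?_ _ ?_ fun he => hij (h1 hi hj he) <;> rw [← h2]
      exacts [Finset.mem_image_of_mem _ hi, Finset.mem_image_of_mem _ hj]
    · refine fun U hU hne hUn => ((h2 ▸ h :).of_image h1 U hU hne hUn).trans (cutIn_mono ?_)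
      exact fun i hi j hj => (hc i hi j hj).ge
  · rw [mult_eq]
    simp only [Nat.zero_testBit, Bool.toNat_false, add_zero]
    cases he : (mask (path X.card)).testBit e
    · exact Nat.zero_le _
    · rw [testBit_mask, path, List.mem_map] at he
      obtain ⟨i, hi, rfl⟩ := he
      rw [List.mem_range] at hi
      rw [show (5 * i + (i + 1)) / 5 = i by omega, show (5 * i + (i + 1)) % 5 = i + 1 by omega]
      exact h3 i (by omega)

theorem Dec.of_isDec (hf : Set.InjOn f (Finset.range n)) (hfX : (Finset.range n).image f = X)
    (hn : n ≤ 5) {cs : List (List ℕ)} (hcs : IsCuts n cs) {T : List ℕ} {L₁ L₂ : ℕ}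
    (hL : ∀ e, mult L₁ L₂ e ≤ m (f (e / 5)) (f (e % 5))) (h : isDec cs T L₁ L₂ = true) :
    Dec X m := by
  subst hfX
  refine Dec.image hf ((isDec_sound hcs h hL).mono fun i _ j hj => ?_)
  rw [Finset.mem_range] at hj
  rw [show (5 * i + j) / 5 = i by omega, show (5 * i + j) % 5 = j by omega]

theorem Dec.of_card_eq_three (hs : Semi X m) (h : KConn 2 X m) (hX : X.card = 3) : Dec X m := by
  obtain ⟨f, h1, h2, L₁, L₂, h3, h4⟩ :=
    exists_of_search hs h hX (by norm_num) (by norm_num) isCuts₃ search₃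
  exact .of_isDec h1 h2 (by norm_num) isCuts₃ h3 h4

theorem Dec.of_card_eq_five (hs : Semi X m) (h : KConn 2 X m) (hX : X.card = 5) : Dec X m := by
  obtain ⟨f, h1, h2, L₁, L₂, h3, h4⟩ :=
    exists_of_search hs h hX (by norm_num) (by norm_num) isCuts₅ search₅
  exact .of_isDec h1 h2 le_rfl isCuts₅ h3 h4

theorem pos_of_land_mask {es : List ℕ} {L₁ L₂ : ℕ} {c : ℕ → ℕ} (hL : ∀ e, mult L₁ L₂ e ≤ c e)
    (h : Nat.beq (Nat.land (mask es) L₁) (mask es) = true) : ∀ e ∈ es, 0 < c e := by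
  intro e he
  refine lt_of_lt_of_le ?_ (hL e)
  have := congrArg (·.testBit e) (Nat.eq_of_beq_eq_true h)
  simp only [Nat.land_eq, Nat.testBit_and, testBit_mask.2 he, Bool.true_and] at this
  simp [mult_eq, this]

theorem dec_or_of_card_eq_four (hs : Semi X m) (h : KConn 2 X m) (hX : X.card = 4) :
    Dec X m ∨ ∃ f : ℕ → V, Set.InjOn f (Finset.range 4) ∧ (Finset.range 4).image f = X ∧
      ∀ e ∈ arcs₄, 0 < m (f (e / 5)) (f (e % 5)) := by
  obtain ⟨f, h1, h2, L₁, L₂, h3, h4⟩ :=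
    exists_of_search hs h hX (by norm_num) (by norm_num) isCuts₄ search₄
  rw [Bool.or_eq_true, Bool.or_eq_true] at h4
  obtain (h4 | h4) | h4 := h4
  · exact .inl (.of_isDec h1 h2 (by norm_num) isCuts₄ h3 h4)
  · exact .inr ⟨f, h1, h2, pos_of_land_mask h3 h4⟩
  · have h5 := pos_of_land_mask h3 h4
    let σ : ℕ → ℕ := fun i => [0, 3, 1, 2].getD i 0
    have hσ : (Finset.range 4).image σ = Finset.range 4 := by decide
    refine .inr ⟨f ∘ σ, h1.comp ?_ fun i hi => ?_, ?_, fun e he => ?_⟩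
    · exact Finset.injOn_of_card_image_eq (by rw [hσ])
    · exact hσ ▸ Finset.mem_image_of_mem σ hi
    · rw [← Finset.image_image, hσ, h2]
    · simp only [arcs₄, List.mem_cons, List.not_mem_nil, or_false] at he
      have h6 : ∀ i < 4, ∀ j < 4, 5 * i + j ∈ arcs₄' → 0 < m (f i) (f j) := fun i _ j _ he => by
        have := h5 _ he
        rwa [show (5 * i + j) / 5 = i by omega, show (5 * i + j) % 5 = j by omega] at this
      rcases he with rfl | rfl | rfl | rfl | rfl | rfl | rfl | rfl <;>
        exact h6 _ (by decide) _ (by decide) (by decide)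

end

/-! ### An extra vertex outside a four-vertex semicomplete part -/

section

variable {V : Type*} [DecidableEq V] {X : Finset V} {m s : V → V → ℕ} {f : ℕ → V}

theorem Dec.of_arcs₄ (hf : Set.InjOn f (Finset.range 5))
    (h : ∀ e ∈ arcs₄, 0 < m (f (e / 5)) (f (e % 5)) + s (f (e / 5)) (f (e % 5)))
    (hr : ∀ i < 4, ∑ j ∈ Finset.range 4, s (f i) (f j) ≤ min 1 (m (f i) (f 4)))
    (hc : ∀ j < 4, ∑ i ∈ Finset.range 4, s (f i) (f j) ≤ min 1 (m (f 4) (f j)))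
    (ht : ∑ i ∈ Finset.range 4, ∑ j ∈ Finset.range 4, s (f i) (f j) ≤ 2)
    (hin : ∀ j < 4, ∀ i < j, 0 < m (f i) (f 4) + m (f j) (f 4))
    (hout : ∀ j < 4, ∀ i < j, 0 < m (f 4) (f i) + m (f 4) (f j)) :
    Dec ((Finset.range 5).image f) m := by
  have key : ∀ es ∈ constraints₄, 1 ≤ (es.map fun e => m (f (e / 5)) (f (e % 5))).sum := by
    have hs : ∀ i < 4, ∀ j < 4, s (f i) (f j) ≤ m (f i) (f 4) ∧ s (f i) (f j) ≤ m (f 4) (f j) :=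
      fun i hi j hj =>
        ⟨((Finset.single_le_sum (f := fun j => s (f i) (f j)) (fun _ _ => Nat.zero_le _)
            (Finset.mem_range.2 hj)).trans (hr i hi)).trans (min_le_right _ _),
          ((Finset.single_le_sum (f := fun i => s (f i) (f j)) (fun _ _ => Nat.zero_le _)
            (Finset.mem_range.2 hi)).trans (hc j hj)).trans (min_le_right _ _)⟩
    simp only [Finset.sum_range_succ, Finset.sum_range_zero, zero_add, le_min_iff] at hr hc ht
    have h0 := hr 0; have h1 := hr 1; have h2 := hr 2; have h3 := hr 3
    have g0 := hc 0; have g1 := hc 1; have g2 := hc 2; have g3 := hc 3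
    clear hr hc
    intro es hes
    simp only [constraints₄, List.mem_append, or_assoc] at hes
    rcases hes with hes | hes | hes | hes
    · simp only [arcs₄, List.forall_mem_cons, Nat.reduceDiv, Nat.reduceMod] at h
      revert es
      simp [arcs₄, List.product]
      omega
    · obtain ⟨⟨a, b, c⟩, hp, rfl⟩ := List.mem_map.1 hes
      simp only [List.mem_filter, List.pair_mem_product, Bool.and_eq_true, decide_eq_true_iff] at hp
      obtain ⟨⟨ha, hb, hc⟩, hab, hbc⟩ := hp
      have hsum : ∑ e ∈ arcs₄.toFinset, s (f (e / 5)) (f (e % 5)) ≤ 2 := by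
        simp [arcs₄]
        omega
      have hsub : ({a, b, c} : Finset ℕ) ⊆ arcs₄.toFinset := by
        simp [Finset.insert_subset_iff, ha, hb, hc]
      have := (Finset.sum_le_sum_of_subset hsub).trans hsum
      rw [Finset.sum_insert (by simp; omega), Finset.sum_pair hbc.ne] at this
      have := h a ha
      have := h b hb
      have := h c hc
      simp only [List.map_cons, List.map_nil, List.sum_cons, List.sum_nil]
      omega
    · obtain ⟨e, he, hes⟩ := List.mem_flatMap.1 hes
      have hlt : ∀ e ∈ arcs₄, e / 5 < 4 ∧ e % 5 < 4 := by decide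
      obtain ⟨hi, hj⟩ := hlt e he
      have := hs _ hi _ hj
      have := h e he
      simp only [List.mem_cons, List.not_mem_nil, or_false] at hes
      rcases hes with rfl | rfl
      · simp only [List.map_cons, List.map_nil, List.sum_cons, List.sum_nil]
        rw [show (5 * (e / 5) + 4) / 5 = e / 5 by omega, show (5 * (e / 5) + 4) % 5 = 4 by omega]
        omega
      · simp only [List.map_cons, List.map_nil, List.sum_cons, List.sum_nil]
        rw [show (20 + e % 5) / 5 = 4 by omega, show (20 + e % 5) % 5 = e % 5 by omega]
        omega
    · simp only [List.mem_flatMap, List.mem_range] at hes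
      obtain ⟨j, hj, i, hi, hes⟩ := hes
      have := hin j hj i hi
      have := hout j hj i hi
      simp only [List.mem_cons, List.not_mem_nil, or_false] at hes
      rcases hes with rfl | rfl
      · simp only [List.map_cons, List.map_nil, List.sum_cons, List.sum_nil]
        rw [show (5 * i + 4) / 5 = i by omega, show (5 * i + 4) % 5 = 4 by omega,
          show (5 * j + 4) / 5 = j by omega, show (5 * j + 4) % 5 = 4 by omega]
        omega
      · simp only [List.map_cons, List.map_nil, List.sum_cons, List.sum_nil]
        rw [show (20 + i) / 5 = 4 by omega, show (20 + i) % 5 = i by omega,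
          show (20 + j) / 5 = 4 by omega, show (20 + j) % 5 = j by omega]
        omega
  obtain ⟨L₁, L₂, h1, h2⟩ := search_sound (c := fun e => m (f (e / 5)) (f (e % 5)))
    (List.forall_mem_map.2 key) (fun e => by simp [mult_eq]) (by simp) search₄'
  exact .of_isDec hf rfl le_rfl isCuts₅ h1 h2

end

/-! ### Semicomplete multigraphs -/

section

variable {V : Type*} [DecidableEq V] {X : Finset V} {m : V → V → ℕ}

/-- A 2-arc-strong semicomplete multigraph with at least five vertices has a strong arc
decomposition. -/
theorem Dec.of_kConn_two (hs : Semi X m) (h : KConn 2 X m) (hX : 5 ≤ X.card) : Dec X m := by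
  induction hn : X.card generalizing X m with
  | zero => omega
  | succ n ih =>
    obtain hX | hX := hX.eq_or_lt
    · exact .of_card_eq_five hs h hX.symm
    wlog hl : ∀ a, m a a = 0 generalizing m
    · refine (this (m := fun a b => if a = b then 0 else m a b) (fun a ha b hb hab => ?_)
        (fun U hU hne hUX => (h U hU hne hUX).trans ?_) (by simp)).mono fun a _ b _ => ?_
      · simpa [hab, hab.symm] using hs a ha b hb hab
      · refine Finset.sum_le_sum fun a _ => Finset.sum_le_sum fun b _ => ?_
        by_cases hab : a = b
        · subst hab
          simp
        · simp [hab]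
      · split_ifs <;> simp
    have hcard : ∀ y ∈ X, (X.erase y).card = n := fun y hy => by
      rw [Finset.card_erase_of_mem hy, hn, Nat.add_sub_cancel]
    have key : ∀ m : V → V → ℕ, Semi X m → KConn 2 X m → (∀ a, m a a = 0) →
        Dec X m ∨ ∀ u ∈ X, ∀ x ∈ X, ∃ v ∈ X, v ≠ x ∧ 0 < m v u := by
      intro m hs h hl
      by_contra! hc
      obtain ⟨hd, u, hu, x, hx, hN⟩ := hc
      have hN' : ∀ a ∈ X, a ≠ x → m a u = 0 := fun a ha hax => by have := hN a ha hax; omega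
      have hxu : x ≠ u := by
        rintro rfl
        obtain ⟨a, ha, b, hb, h1, h2, h3⟩ := (h.anti one_le_two).exists_arc (U := {x}) (by simpa)
          (by simp) (by rintro rfl; simp at hX)
        simp only [Finset.mem_singleton] at h1 h2
        subst h2
        exact h3.ne' (hN' a ha h1)
      refine hd (.of_contract (ih hs.contract (h.contract hx hu hxu hN') ?_ (hcard u hu)) h hs
        (by omega) hx hu hxu hN')
      rw [hcard u hu]
      omega
    obtain hd | hin := key m hs h hl
    · exact hd
    obtain hd | hout := key (rev m) hs.rev h.rev hl
    · exact hd.rev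
    obtain ⟨y, hy, h1, h2, h3⟩ := h.exists_tightMeet hs hl (by omega) hin hout
    refine .of_exists_splitting (fun m' hm' h' => ih (fun a ha b hb hab => ?_) h' ?_ (hcard y hy))
      h hy (by omega) h1 h2 h3
    · have := hs a (Finset.mem_of_mem_erase ha) b (Finset.mem_of_mem_erase hb) hab
      have := hm' a b
      have := hm' b a
      omega
    · rw [hcard y hy]
      omega

end

/-! ### Split digraphs -/

section

variable {V : Type*} [DecidableEq V] {X U V₁ V₂ : Finset V} {m : V → V → ℕ} {A : Finset (V × V)}
  {S : Multiset (V × V × V)} {B : Multiset (V × V)} {t u v : V}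

theorem sum_count_eq_card_filter {α : Type*} [DecidableEq α] (F : Finset α) (S : Multiset α) :
    ∑ x ∈ F, S.count x = Multiset.card (S.filter (· ∈ F)) := by
  induction S using Multiset.induction_on with
  | empty => simp
  | cons a S ih =>
    simp only [Multiset.count_cons, Finset.sum_add_distrib, ih, Finset.sum_ite_eq']
    by_cases h : a ∈ F <;> simp [h]

theorem Dec.strongArcDecomp [Fintype V]
    (h : Dec Finset.univ fun a b => if (a, b) ∈ A then 1 else 0) : StrongArcDecomp A := by
  obtain ⟨p, q, hpq, hp, hq⟩ := h
  have hpq' : ∀ a b, p a b + q a b ≤ if (a, b) ∈ A then 1 else 0 := fun a b =>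
    hpq a (Finset.mem_univ _) b (Finset.mem_univ _)
  have key : ∀ (r : V → V → ℕ) (A' : Finset (V × V)), KConn 1 Finset.univ r →
      (∀ a b, 0 < r a b → (a, b) ∈ A') → DigraphStrong A' := by
    classical
    intro r A' hr hA x y
    by_contra hxy
    obtain ⟨a, -, b, -, ha, hb, hab⟩ := hr.exists_arc
      (U := Finset.univ.filter fun b => ¬ Relation.ReflTransGen (fun a b => (a, b) ∈ A') x b)
      (Finset.subset_univ _) ⟨y, by simpa⟩ fun h => by
        have := h ▸ Finset.mem_univ x
        simp [Relation.ReflTransGen.refl] at this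
    simp only [Finset.mem_filter, Finset.mem_univ, true_and, not_not] at ha hb
    exact hb (ha.tail (hA a b hab))
  refine ⟨A.filter fun e => 0 < p e.1 e.2, A.filter fun e => ¬ 0 < p e.1 e.2,
    Finset.filter_union_filter_not_eq _ _, Finset.disjoint_filter_filter_not _ _ _,
    key p _ hp fun a b hab => ?_, key q _ hq fun a b hab => ?_⟩ <;>
  · have := hpq' a b
    split_ifs at this with hA
    · simp only [Finset.mem_filter, hA, true_and]
      omega
    · omega

/-- The multigraph on `X` obtained from `A` by the splittings in `S` at vertices outside `X`. -/
def lift [Fintype V] (A : Finset (V × V)) (S : Multiset (V × V × V)) (X : Finset V) :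
    V → V → ℕ :=
  fun a b => (if (a, b) ∈ A then 1 else 0) + ∑ t ∈ Xᶜ, S.count (a, t, b)

theorem lift_eq_add [Fintype V] (A : Finset (V × V)) (S : Multiset (V × V × V)) (ht : t ∉ X) :
    lift A S X = lift A S (insert t X) + fun a b => S.count (a, t, b) := by
  ext a b
  rw [Pi.add_apply, Pi.add_apply, lift, lift, add_assoc, Finset.compl_insert,
    Finset.sum_erase_add _ _ (Finset.mem_compl.2 ht)]

theorem sum_count_le_card_filter {T : V → V × V × V} (hT : Set.InjOn T X)
    {P : V × V × V → Prop} [DecidablePred P] (hP : ∀ x ∈ X, P (T x)) :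
    ∑ x ∈ X, S.count (T x) ≤ Multiset.card (S.filter P) := by
  rw [← Finset.sum_image (f := fun x => S.count x) hT, sum_count_eq_card_filter]
  refine Multiset.card_le_card (Multiset.monotone_filter_right _ fun x hx => ?_)
  obtain ⟨y, hy, rfl⟩ := Finset.mem_image.1 hx
  exact hP y hy

theorem nodup_of_splitsOff (hB : SplitsOff A V₁ V₂ S B) :
    (S.map fun s => (s.1, s.2.1)).Nodup ∧ (S.map fun s => (s.2.1, s.2.2)).Nodup := by
  have := hB.2.1
  have h : (S.bind fun s => ({(s.1, s.2.1), (s.2.1, s.2.2)} : Multiset (V × V))) =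
      (S.map fun s => (s.1, s.2.1)) + S.map fun s => (s.2.1, s.2.2) := by
    rw [← Multiset.bind_singleton, ← Multiset.bind_singleton, ← Multiset.bind_add]
    rfl
  rw [h, Multiset.nodup_add] at this
  exact ⟨this.1, this.2.1⟩

theorem sum_count_out_le (hB : SplitsOff A V₁ V₂ S B) :
    ∑ v ∈ X, S.count (u, t, v) ≤ if (u, t) ∈ A then 1 else 0 := by
  have h : ∑ v ∈ X, S.count (u, t, v) ≤ (S.map fun s => (s.1, s.2.1)).count (u, t) := by
    rw [Multiset.count_map]
    exact sum_count_le_card_filter (T := fun v => (u, t, v)) (fun a _ b _ h => by simpa using h)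
      (by simp)
  refine h.trans ?_
  split_ifs with hA
  · exact Multiset.nodup_iff_count_le_one.1 (nodup_of_splitsOff hB).1 _
  · rw [Nat.le_zero, Multiset.count_eq_zero, Multiset.mem_map]
    rintro ⟨s, hs, he⟩
    exact hA (he ▸ (hB.1 s hs).2.2.2.2.1)

theorem sum_count_in_le (hB : SplitsOff A V₁ V₂ S B) :
    ∑ u ∈ X, S.count (u, t, v) ≤ if (t, v) ∈ A then 1 else 0 := by
  have h : ∑ u ∈ X, S.count (u, t, v) ≤ (S.map fun s => (s.2.1, s.2.2)).count (t, v) := by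
    rw [Multiset.count_map]
    exact sum_count_le_card_filter (T := fun u => (u, t, v)) (fun a _ b _ h => by simpa using h)
      (by simp)
  refine h.trans ?_
  split_ifs with hA
  · exact Multiset.nodup_iff_count_le_one.1 (nodup_of_splitsOff hB).2 _
  · rw [Nat.le_zero, Multiset.count_eq_zero, Multiset.mem_map]
    rintro ⟨s, hs, he⟩
    exact hA (he ▸ (hB.1 s hs).2.2.2.2.2)

theorem sum_sum_count_le (X : Finset V) (S : Multiset (V × V × V)) (t : V) :
    ∑ u ∈ X, ∑ v ∈ X, S.count (u, t, v) ≤ Multiset.card (S.filter fun s => s.2.1 = t) := by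
  rw [← Finset.sum_product' (f := fun u v => S.count (u, t, v)),
    ← Finset.sum_image (f := fun x => S.count x) (g := fun e : V × V => (e.1, t, e.2))
      (by rintro ⟨a, b⟩ - ⟨c, d⟩ - h; simpa using h), sum_count_eq_card_filter]
  refine Multiset.card_le_card (Multiset.monotone_filter_right _ fun x hx => ?_)
  obtain ⟨y, hy, rfl⟩ := Finset.mem_image.1 hx
  rfl

variable [Fintype V]

theorem inDeg_le (hsplit : IsSplitDigraph V₁ V₂ A) (ht : t ∈ V₁) (hX : V₂ ⊆ X) :
    inDeg A t ≤ ∑ u ∈ X, if (u, t) ∈ A then 1 else 0 := by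
  obtain ⟨-, -, -, h1, -, h2, -⟩ := hsplit
  rw [← Finset.card_filter]
  refine Finset.card_le_card_of_injOn Prod.fst ?_ ?_
  · rintro ⟨u, v⟩ he
    obtain ⟨hA, rfl⟩ := Finset.mem_filter.1 he
    refine Finset.mem_filter.2 ⟨hX ?_, hA⟩
    exact (Finset.mem_union.1 (h1 ▸ Finset.mem_univ u)).resolve_left fun hu => h2 u hu _ ht hA
  · rintro ⟨a, b⟩ h ⟨c, d⟩ h' hac
    have h := (Finset.mem_filter.1 h).2
    have h' := (Finset.mem_filter.1 h').2
    simp_all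

theorem outDeg_le (hsplit : IsSplitDigraph V₁ V₂ A) (ht : t ∈ V₁) (hX : V₂ ⊆ X) :
    outDeg A t ≤ ∑ u ∈ X, if (t, u) ∈ A then 1 else 0 := by
  obtain ⟨-, -, -, h1, -, h2, -⟩ := hsplit
  rw [← Finset.card_filter]
  refine Finset.card_le_card_of_injOn Prod.snd ?_ ?_
  · rintro ⟨u, v⟩ he
    obtain ⟨hA, rfl⟩ := Finset.mem_filter.1 he
    refine Finset.mem_filter.2 ⟨hX ?_, hA⟩
    exact (Finset.mem_union.1 (h1 ▸ Finset.mem_univ v)).resolve_left fun hv => h2 _ ht v hv hA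
  · rintro ⟨a, b⟩ h ⟨c, d⟩ h' hac
    have h := (Finset.mem_filter.1 h).2
    have h' := (Finset.mem_filter.1 h').2
    simp_all

theorem lift_of_mem_left (hsplit : IsSplitDigraph V₁ V₂ A) (hB : SplitsOff A V₁ V₂ S B)
    (ht : t ∈ V₁) : lift A S X u t = (if (u, t) ∈ A then 1 else 0) ∧
      lift A S X t u = if (t, u) ∈ A then 1 else 0 := by
  have h : t ∉ V₂ := fun h => Finset.disjoint_left.1 hsplit.2.2.1 ht h
  constructor <;>
  · rw [lift, Nat.add_eq_left]
    refine Finset.sum_eq_zero fun x _ => Multiset.count_eq_zero.2 fun hs => h ?_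
    first | exact (hB.1 _ hs).2.1 | exact (hB.1 _ hs).2.2.1

theorem Dec.insert_lift (hsplit : IsSplitDigraph V₁ V₂ A)
    (hdeg : ∀ t ∈ V₁, 3 ≤ outDeg A t ∧ 3 ≤ inDeg A t) (hB : SplitsOff A V₁ V₂ S B)
    (htwo : ∀ t ∈ V₁, (S.filter fun s => s.2.1 = t).card ≤ 2) (hX : V₂ ⊆ X)
    (h : Dec X (lift A S X)) (ht : t ∉ X) : Dec (insert t X) (lift A S (insert t X)) := by
  have ht₁ : t ∈ V₁ := (Finset.mem_union.1 (hsplit.2.2.2.1 ▸ Finset.mem_univ t)).resolve_right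
    fun h => ht (hX h)
  have hin := (hdeg t ht₁).2.trans (inDeg_le hsplit ht₁ hX)
  have hout := (hdeg t ht₁).1.trans (outDeg_le hsplit ht₁ hX)
  have hS := (sum_sum_count_le X S t).trans (htwo t ht₁)
  rw [lift_eq_add A S ht] at h
  have hl := fun u => lift_of_mem_left (u := u) (X := insert t X) hsplit hB ht₁
  refine h.unsplit ht (fun u _ => ?_) (fun v _ => ?_) ?_ ?_ ?_ ?_ <;>
    simp only [(hl _).1, (hl _).2]
  · exact sum_count_out_le hB
  · exact sum_count_in_le hB
  all_goals omega

theorem Dec.lift_univ (hsplit : IsSplitDigraph V₁ V₂ A)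
    (hdeg : ∀ t ∈ V₁, 3 ≤ outDeg A t ∧ 3 ≤ inDeg A t) (hB : SplitsOff A V₁ V₂ S B)
    (htwo : ∀ t ∈ V₁, (S.filter fun s => s.2.1 = t).card ≤ 2) (hX : V₂ ⊆ X)
    (h : Dec X (lift A S X)) : Dec Finset.univ (lift A S Finset.univ) := by
  induction hn : Xᶜ.card generalizing X with
  | zero =>
    rw [Finset.card_eq_zero, Finset.compl_eq_empty_iff] at hn
    exact hn ▸ h
  | succ n ih =>
    obtain ⟨t, ht⟩ := Finset.card_pos.1 (n.succ_pos.trans_eq hn.symm)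
    have := Finset.mem_compl.1 ht
    refine ih (hX.trans (Finset.subset_insert t X)) (.insert_lift hsplit hdeg hB htwo hX h this) ?_
    rw [Finset.compl_insert, Finset.card_erase_of_mem ht, hn, Nat.add_sub_cancel]

theorem count_le_lift (hsplit : IsSplitDigraph V₁ V₂ A) (hB : SplitsOff A V₁ V₂ S B) (a b : V) :
    B.count (a, b) ≤ lift A S V₂ a b := by
  rw [hB.2.2, Multiset.count_add]
  refine add_le_add ((Multiset.count_le_of_le _ (Multiset.sub_le_self _ _)).trans ?_) ?_
  · split_ifs with h
    · exact Multiset.nodup_iff_count_le_one.1 A.nodup _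
    · exact (Multiset.count_eq_zero.2 h).le
  · rw [Multiset.count_map, ← Finset.sum_image (f := fun x => S.count x)
      (g := fun t => (a, t, b)) (by intro x _ y _ h; simpa using h), sum_count_eq_card_filter]
    refine Multiset.card_le_card (Multiset.le_iff_count.2 fun x => ?_)
    by_cases hx : x ∈ S
    · simp only [Multiset.count_filter, Prod.mk.injEq]
      split_ifs with h1 h2 h2
      · exact le_rfl
      · refine absurd (Finset.mem_image.2 ⟨x.2.1, ?_, ?_⟩) h2
        · exact Finset.mem_compl.2 (Finset.disjoint_left.1 hsplit.2.2.1 (hB.1 x hx).1)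
        · rw [h1.1, h1.2]
      all_goals exact Nat.zero_le _
    · rw [Multiset.count_eq_zero.2 fun h => hx (Multiset.mem_filter.1 h).1]
      exact Nat.zero_le _

theorem kConn_lift (hsplit : IsSplitDigraph V₁ V₂ A) (hB : SplitsOff A V₁ V₂ S B)
    (h2 : MArcStrongOn 2 V₂ (B.filter fun e => e.1 ∈ V₂ ∧ e.2 ∈ V₂)) :
    KConn 2 V₂ (lift A S V₂) := by
  intro U hU hne hUV
  by_contra! hlt
  set B' := B.filter fun e => e.1 ∈ V₂ ∧ e.2 ∈ V₂ with hB'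
  have hC : Multiset.card (B'.filter fun e => e.1 ∉ U ∧ e.2 ∈ U) < 2 := by
    refine lt_of_le_of_lt ?_ hlt
    have : ∀ e ∈ B'.filter (fun e => e.1 ∉ U ∧ e.2 ∈ U), e ∈ V₂ ×ˢ V₂ := fun e he =>
      Finset.mem_product.2 (Multiset.mem_filter.1 (Multiset.mem_filter.1 he).1).2
    rw [← Multiset.sum_count_eq_card this, Finset.sum_product]
    refine Finset.sum_le_sum fun a _ => Finset.sum_le_sum fun b _ => ?_
    rw [Multiset.count_filter]
    split_ifs
    · exact (Multiset.count_le_of_le _ (Multiset.filter_le _ _)).trans (count_le_lift hsplit hB a b)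
    · rfl
  obtain ⟨y, hy⟩ := hne
  obtain ⟨x, hx, hxU⟩ : ∃ x ∈ V₂, x ∉ U := by
    by_contra! hc
    exact hUV (hU.antisymm hc)
  have hxy := h2 _ (Multiset.filter_le _ _) hC x hx y (hU hy)
  clear_value B'
  have : y ∉ U := by
    clear hy
    induction hxy with
    | refl => exact hxU
    | tail _ hbc ih =>
      intro hc
      have h3 := hbc.2.2
      rw [Multiset.sub_filter_eq_filter_not] at h3
      exact (Multiset.mem_filter.1 h3).2 ⟨ih, hc⟩
  exact this hy

theorem semi_lift (hsplit : IsSplitDigraph V₁ V₂ A) (S : Multiset (V × V × V)) :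
    Semi V₂ (lift A S X) := fun a ha b hb hab => by
  unfold lift
  obtain h | h := hsplit.2.2.2.2.2.2 a ha b hb hab <;> simp [h]

theorem Dec.insert_lift_of_arcs₄ {f : ℕ → V} {t : V} (hsplit : IsSplitDigraph V₁ V₂ A)
    (hdeg : ∀ t ∈ V₁, 3 ≤ outDeg A t ∧ 3 ≤ inDeg A t) (hB : SplitsOff A V₁ V₂ S B)
    (htwo : ∀ t ∈ V₁, (S.filter fun s => s.2.1 = t).card ≤ 2) (ht : t ∈ V₁)
    (hf : Set.InjOn f (Finset.range 4)) (hfV : (Finset.range 4).image f = V₂)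
    (h : ∀ e ∈ arcs₄, 0 < lift A S V₂ (f (e / 5)) (f (e % 5))) :
    Dec (insert t V₂) (lift A S (insert t V₂)) := by
  have htV : t ∉ V₂ := Finset.disjoint_left.1 hsplit.2.2.1 ht
  have hsum : ∀ g : V → ℕ, ∑ i ∈ Finset.range 4, g (f i) = ∑ v ∈ V₂, g v := fun g => by
    rw [← hfV, Finset.sum_image hf]
  have hfi : ∀ i < 4, f i ∈ V₂ := fun i hi =>
    hfV ▸ Finset.mem_image_of_mem f (Finset.mem_range.2 hi)
  have hin := (hdeg t ht).2.trans (inDeg_le hsplit ht le_rfl)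
  have hout := (hdeg t ht).1.trans (outDeg_le hsplit ht le_rfl)
  rw [lift_eq_add A S htV] at h
  have hl := fun u => lift_of_mem_left (u := u) (X := insert t V₂) hsplit hB ht
  set F : ℕ → V := fun i => if i < 4 then f i else t with hF
  have hF4 : F 4 = t := rfl
  have hFi : ∀ i < 4, F i = f i := fun i hi => if_pos hi
  have hFinj : Set.InjOn F (Finset.range 5) := by
    intro i hi j hj hij
    simp only [Finset.coe_range, Set.mem_Iio] at hi hj
    obtain hi' | rfl : i < 4 ∨ i = 4 := by omega
    · obtain hj' | rfl : j < 4 ∨ j = 4 := by omega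
      · rw [hFi i hi', hFi j hj'] at hij
        exact hf (by simpa) (by simpa) hij
      · exact absurd (hfi i hi') (by rwa [← hFi i hi', hij])
    · obtain hj' | rfl : j < 4 ∨ j = 4 := by omega
      · exact absurd (hfi j hj') (by rwa [← hFi j hj', ← hij])
      · rfl
  have hFV : (Finset.range 5).image F = insert t V₂ := by
    rw [Finset.range_add_one, Finset.image_insert, hF4, ← hfV]
    exact congrArg _ (Finset.image_congr fun i hi => hFi i (by simpa using hi))
  have hFsum : ∀ g : V → ℕ, ∑ i ∈ Finset.range 4, g (F i) = ∑ v ∈ V₂, g v := fun g => by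
    rw [← hsum g]
    exact Finset.sum_congr rfl fun i hi => by rw [hFi i (Finset.mem_range.1 hi)]
  rw [← hFsum] at hin hout
  rw [← hFV] at hl ⊢
  refine Dec.of_arcs₄ (s := fun a b => S.count (a, t, b)) hFinj (fun e he => ?_) (fun i hi => ?_)
    (fun j hj => ?_) ?_ (fun j hj i hij => ?_) fun j hj i hij => ?_
  · have he' : e / 5 < 4 ∧ e % 5 < 4 := by
      revert he
      revert e
      decide
    rw [hFi _ he'.1, hFi _ he'.2, hFV]
    exact h e he
  · rw [hF4, (hl _).1, hFsum fun v => S.count (F i, t, v)]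
    refine (sum_count_out_le hB).trans ?_
    split_ifs <;> simp
  · rw [hF4, (hl _).2, hFsum fun v => S.count (v, t, F j)]
    refine (sum_count_in_le hB).trans ?_
    split_ifs <;> simp
  · rw [Finset.sum_congr rfl fun i _ => hFsum fun v => S.count (F i, t, v),
      hFsum fun u => ∑ v ∈ V₂, S.count (u, t, v)]
    exact (sum_sum_count_le V₂ S t).trans (htwo t ht)
  · rw [hF4, (hl _).1, (hl _).1]
    simp only [Finset.sum_range_succ, Finset.sum_range_zero] at hin
    interval_cases j <;> interval_cases i <;> grind
  · rw [hF4, (hl _).2, (hl _).2]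
    simp only [Finset.sum_range_succ, Finset.sum_range_zero] at hout
    interval_cases j <;> interval_cases i <;> grind

end

end ArcDecomp

/-- Corollary 2.7: let `D = (V₁, V₂; A)` be a split digraph in which every vertex of
`V₁` has out- and in-degree at least 3, and let `D*` (with arc multiset `B`) be
obtained from `D` by splitting off at most two pairs at every vertex of `V₁`.
If `D*⟨V₂⟩` is 2-arc-strong, then `D` has a strong arc decomposition. -/
theorem stmt7 {V : Type*} [Fintype V] [DecidableEq V]
    (V₁ V₂ : Finset V) (A : Finset (V × V))
    (hsplit : IsSplitDigraph V₁ V₂ A)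
    (hdeg : ∀ t ∈ V₁, 3 ≤ outDeg A t ∧ 3 ≤ inDeg A t)
    (S : Multiset (V × V × V)) (B : Multiset (V × V))
    (hB : SplitsOff A V₁ V₂ S B)
    (htwo : ∀ t ∈ V₁, (S.filter fun s => s.2.1 = t).card ≤ 2)
    (h2 : MArcStrongOn 2 V₂ (B.filter fun e => e.1 ∈ V₂ ∧ e.2 ∈ V₂)) :
    StrongArcDecomp A := by
  have hk := ArcDecomp.kConn_lift hsplit hB h2
  have hs := ArcDecomp.semi_lift hsplit S (X := V₂)
  obtain ⟨t, ht⟩ := hsplit.1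
  have hcard : 3 ≤ V₂.card := by
    refine (hdeg t ht).2.trans ((ArcDecomp.inDeg_le hsplit ht le_rfl).trans ?_)
    rw [← Finset.card_filter]
    exact Finset.card_filter_le _ _
  have huniv : ArcDecomp.Dec Finset.univ (ArcDecomp.lift A S Finset.univ) := by
    obtain h | h | h : V₂.card = 3 ∨ V₂.card = 4 ∨ 5 ≤ V₂.card := by omega
    · exact (ArcDecomp.Dec.of_card_eq_three hs hk h).lift_univ hsplit hdeg hB htwo le_rfl
    · obtain h | ⟨f, hf, hfV, h⟩ := ArcDecomp.dec_or_of_card_eq_four hs hk h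
      · exact h.lift_univ hsplit hdeg hB htwo le_rfl
      · exact (ArcDecomp.Dec.insert_lift_of_arcs₄ hsplit hdeg hB htwo ht hf hfV h).lift_univ hsplit
          hdeg hB htwo (Finset.subset_insert _ _)
    · exact (ArcDecomp.Dec.of_kConn_two hs hk h).lift_univ hsplit hdeg hB htwo le_rfl
  refine ArcDecomp.Dec.strongArcDecomp ?_
  convert huniv using 3
  simp [ArcDecomp.lift]
end

section
/- Let T be a semicomplete digraph and let S1,…,Sk be the acyclic ordering of its strong components. Suppose a vertex x of T has exactly one out-arc xy in T. Then either (i) k ≥ 2, V(S_{k−1}) = {x} and V(S_k) = {y}, or (ii) both x and y belong to V(S_k) and xy is a cut-arc of S_k. -/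
/-- Reachability in the digraph with arc set `A`. -/
def Reach {V : Type*} (A : Finset (V × V)) (x y : V) : Prop :=
  Relation.ReflTransGen (fun a b => (a, b) ∈ A) x y

/-- `C` is a strong component of the digraph with arc set `A`: it is the set of
all vertices mutually reachable with some vertex `v`. -/
def IsSCC {V : Type*} (A : Finset (V × V)) (C : Finset V) : Prop :=
  ∃ v : V, ∀ u : V, u ∈ C ↔ (Reach A v u ∧ Reach A u v)

/-- In the digraph with arc set `A`, every ordered pair of vertices of `X` is joined
by a directed path all of whose vertices lie in `X` (i.e. the subdigraph induced by
`X` is strong). -/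
def StrongOn {V : Type*} (X : Finset V) (A : Finset (V × V)) : Prop :=
  ∀ x ∈ X, ∀ y ∈ X, Relation.ReflTransGen (fun a b => a ∈ X ∧ b ∈ X ∧ (a, b) ∈ A) x y

/-- A vertex reachable from `x` along a nontrivial path is reached through an out-neighbour. -/
theorem Reach.exists_arc {V : Type*} {A : Finset (V × V)} {x u : V}
    (h : Reach A x u) (hne : u ≠ x) : ∃ z, (x, z) ∈ A ∧ Reach A z u := by
  rcases Relation.ReflTransGen.cases_head h with rfl | h
  · exact absurd rfl hne
  · exact h

theorem IsSCC.nonempty {V : Type*} {A : Finset (V × V)} {C : Finset V}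
    (h : IsSCC A C) : ∃ v, v ∈ C :=
  h.imp fun v hv => (hv v).2 ⟨.refl, .refl⟩

theorem IsSCC.reach {V : Type*} {A : Finset (V × V)} {C : Finset V}
    (h : IsSCC A C) {a b : V} (ha : a ∈ C) (hb : b ∈ C) : Reach A a b := by
  obtain ⟨v, hv⟩ := h
  exact ((hv a).1 ha).2.trans ((hv b).1 hb).1

/-- Removing the only out-arc of a vertex destroys strong connectivity. -/
theorem not_strongOn_erase {V : Type*} [DecidableEq V] {A : Finset (V × V)} {X : Finset V}
    {x y : V} (hx : x ∈ X) (hy : y ∈ X) (hne : x ≠ y)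
    (huniq : ∀ z : V, (x, z) ∈ A → z = y) : ¬ StrongOn X (A.erase (x, y)) := by
  intro h
  rcases Relation.ReflTransGen.cases_head (h x hx y hy) with h | ⟨z, ⟨-, -, hz⟩, -⟩
  · exact hne h
  · rw [Finset.mem_erase] at hz
    exact hz.1 (by rw [huniq z hz.2])

/-- Observation 3.1: let `T` be a semicomplete digraph with acyclic ordering
`S 0, …, S (k-1)` of its strong components and suppose `xy` is the unique out-arc of
`x`.  Then either `k ≥ 2`, `S (k-2) = {x}` and `S (k-1) = {y}`, or both `x` and `y`
lie in the terminal component `S (k-1)` and `xy` is a cut-arc of it. -/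
theorem stmt8 {V : Type*} [Fintype V] [DecidableEq V]
    (A : Finset (V × V))
    (hloop : ∀ v : V, (v, v) ∉ A)
    (hsemi : ∀ u v : V, u ≠ v → (u, v) ∈ A ∨ (v, u) ∈ A)
    (k : ℕ) (hk : 1 ≤ k) (S : Fin k → Finset V)
    (hscc : ∀ i, IsSCC A (S i))
    (hcover : ∀ v : V, ∃ i, v ∈ S i)
    (hdisj : ∀ i j, i ≠ j → Disjoint (S i) (S j))
    (hord : ∀ i j : Fin k, i < j → ∀ a ∈ S j, ∀ b ∈ S i, (a, b) ∉ A)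
    (x y : V) (hxy : (x, y) ∈ A) (huniq : ∀ z : V, (x, z) ∈ A → z = y) :
    (∃ h2 : 2 ≤ k, S ⟨k - 2, by omega⟩ = {x} ∧ S ⟨k - 1, by omega⟩ = {y}) ∨
    (x ∈ S ⟨k - 1, by omega⟩ ∧ y ∈ S ⟨k - 1, by omega⟩ ∧
      ¬ StrongOn (S ⟨k - 1, by omega⟩) (A.erase (x, y))) := by
  have hne : x ≠ y := by
    rintro rfl
    exact hloop _ hxy
  have hunique : ∀ {i j : Fin k} {v : V}, v ∈ S i → v ∈ S j → i = j := by
    intro i j v hi hj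
    by_contra hij
    exact Finset.disjoint_left.1 (hdisj i j hij) hi hj
  obtain ⟨i, hi⟩ := hcover x
  by_cases hlast : i.val = k - 1
  · right
    obtain rfl : i = ⟨k - 1, Nat.sub_one_lt_of_le hk le_rfl⟩ := Fin.ext hlast
    obtain ⟨j, hj⟩ := hcover y
    obtain rfl : j = ⟨k - 1, Nat.sub_one_lt_of_le hk le_rfl⟩ := by
      by_contra hjk
      refine hord j _ (lt_of_le_of_ne ?_ hjk) x hi y hj hxy
      rw [Fin.le_def]
      exact Nat.le_sub_one_of_lt j.isLt
    exact ⟨hi, hj, not_strongOn_erase hi hj hne huniq⟩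
  · left
    have hlater : ∀ m : Fin k, i < m → ∀ z ∈ S m, z = y := by
      intro m him z hz
      have hxz : x ≠ z := by
        rintro rfl
        exact him.ne (hunique hi hz)
      exact huniq z ((hsemi x z hxz).resolve_right (hord i m him z hz x hi))
    have hsingle : ∀ m : Fin k, i < m → S m = {y} := by
      intro m him
      obtain ⟨v, hv⟩ := (hscc m).nonempty
      refine Finset.eq_singleton_iff_unique_mem.2 ⟨?_, hlater m him⟩
      exact hlater m him v hv ▸ hv
    have hik := i.isLt
    have hT := hsingle ⟨k - 1, by omega⟩ (Fin.lt_def.2 (by simp only; omega))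
    have hyT : y ∈ S ⟨k - 1, by omega⟩ := by rw [hT]; exact Finset.mem_singleton_self y
    have hi2 : i.val = k - 2 := by
      by_contra hi2
      have hS := hsingle ⟨k - 2, by omega⟩ (Fin.lt_def.2 (by simp only; omega))
      have := congrArg Fin.val (hunique hyT (hS ▸ Finset.mem_singleton_self y))
      simp only at this
      omega
    have hsink : ∀ z, (y, z) ∉ A := by
      intro z hz
      obtain ⟨m, hm⟩ := hcover z
      by_cases hmk : m.val = k - 1
      · obtain rfl : m = ⟨k - 1, Nat.sub_one_lt_of_le hk le_rfl⟩ := Fin.ext hmk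
        rw [hT, Finset.mem_singleton] at hm
        exact hloop y (hm ▸ hz)
      · exact hord m ⟨k - 1, by omega⟩ (Fin.lt_def.2 (by simp only; omega)) y hyT z hm hz
    obtain rfl : i = ⟨k - 2, Nat.sub_lt hk two_pos⟩ := Fin.ext hi2
    refine ⟨by omega, Finset.eq_singleton_iff_unique_mem.2 ⟨hi, fun u hu => ?_⟩, hT⟩
    by_contra hux
    obtain ⟨z, hz, hzu⟩ := ((hscc _).reach hi hu).exists_arc hux
    obtain rfl := huniq z hz
    by_cases huz : u = z
    · subst huz
      have := congrArg Fin.val (hunique hyT hu)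
      simp only at this
      omega
    · obtain ⟨w, hw, -⟩ := hzu.exists_arc huz
      exact hsink w hw
end

section
/- Let D=(V1,V2;A) be a split digraph, let S1,…,Sk be the acyclic ordering of the strong components of the semicomplete digraph D⟨V2⟩, and let P be a directed path in D starting at a vertex of S_k and ending at a vertex of S_1 (in particular both endpoints of P lie in V2). Then the directed multigraph D_P⟨V2⟩ on vertex set V2, obtained from D⟨V2⟩ by splitting off the path P (i.e., adding, for each vertex t ∈ V(P)∩V1 with predecessor t⁻ and successor t⁺ on P, the splitting arc t⁻t⁺), is strong. -/
/-- Reachability inside `X` in the digraph with arc set `A`. -/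
def ReachOn {V : Type*} (X : Finset V) (A : Finset (V × V)) (x y : V) : Prop :=
  Relation.ReflTransGen (fun a b => a ∈ X ∧ b ∈ X ∧ (a, b) ∈ A) x y

/-- `C` is a strong component of the subdigraph induced by `X`. -/
def IsSCCOn {V : Type*} (X : Finset V) (A : Finset (V × V)) (C : Finset V) : Prop :=
  ∃ v ∈ X, ∀ u : V, u ∈ C ↔ (u ∈ X ∧ ReachOn X A v u ∧ ReachOn X A u v)

/-- Lemma 3.3: let `D = (V₁, V₂; A)` be a split digraph, `S 0, …, S (k-1)` the acyclic
ordering of the strong components of the semicomplete digraph `D⟨V₂⟩`, and `P`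
(given by the injective sequence of vertices `P 0, …, P m` with consecutive arcs) a
directed path of `D` from a vertex of the terminal component `S (k-1)` to a vertex
of the initial component `S 0`.  Then the directed multigraph on `V₂` obtained from
`D⟨V₂⟩` by adding, for every interior vertex `P i ∈ V₁` of `P`, the splitting arc
from `P (i-1)` to `P (i+1)`, is strong. -/
theorem stmt10 {V : Type*} [Fintype V] [DecidableEq V]
    (V₁ V₂ : Finset V) (A : Finset (V × V))
    (hsplit : IsSplitDigraph V₁ V₂ A)
    (k : ℕ) (hk : 1 ≤ k) (S : Fin k → Finset V)
    (hscc : ∀ i, IsSCCOn V₂ A (S i))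
    (hcover : ∀ v ∈ V₂, ∃ i, v ∈ S i)
    (hdisj : ∀ i j, i ≠ j → Disjoint (S i) (S j))
    (hord : ∀ i j : Fin k, i < j → ∀ a ∈ S j, ∀ b ∈ S i, (a, b) ∉ A)
    (m : ℕ) (P : Fin (m + 1) → V)
    (hPinj : Function.Injective P)
    (hParc : ∀ i : Fin m, (P i.castSucc, P i.succ) ∈ A)
    (hP0 : P 0 ∈ S ⟨k - 1, by omega⟩)
    (hPlast : P (Fin.last m) ∈ S ⟨0, by omega⟩) :
    MStrongOn V₂
      ((A.filter fun e => e.1 ∈ V₂ ∧ e.2 ∈ V₂).val +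
        (Finset.univ : Finset (Fin (m + 1))).val.filterMap (fun i =>
          if h : 0 < i.val ∧ i.val < m ∧ P i ∈ V₁ then
            some (P ⟨i.val - 1, Nat.lt_of_le_of_lt (Nat.sub_le _ _) i.isLt⟩,
                  P ⟨i.val + 1, Nat.succ_lt_succ h.2.1⟩)
          else none)) := by
  obtain ⟨-, -, hdis, huniv, -, hind, hsemi⟩ := hsplit
  have mem_of_not_mem : ∀ v, v ∉ V₁ → v ∈ V₂ := fun v hv =>
    (Finset.mem_union.mp (huniv ▸ Finset.mem_univ v)).resolve_left hv
  set B := ((A.filter fun e => e.1 ∈ V₂ ∧ e.2 ∈ V₂).val +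
        (Finset.univ : Finset (Fin (m + 1))).val.filterMap (fun i =>
          if h : 0 < i.val ∧ i.val < m ∧ P i ∈ V₁ then
            some (P ⟨i.val - 1, Nat.lt_of_le_of_lt (Nat.sub_le _ _) i.isLt⟩,
                  P ⟨i.val + 1, Nat.succ_lt_succ h.2.1⟩)
          else none))
  have arc_mem : ∀ a b, a ∈ V₂ → b ∈ V₂ → (a, b) ∈ A → (a, b) ∈ B := by
    intro a b ha hb hab
    exact Multiset.mem_add.mpr (Or.inl (Finset.mem_filter.mpr ⟨hab, ha, hb⟩))
  have split_mem : ∀ n (h : n + 2 < m + 1), P ⟨n + 1, by omega⟩ ∈ V₁ →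
      (P ⟨n, by omega⟩, P ⟨n + 2, h⟩) ∈ B := by
    intro n h hP
    refine Multiset.mem_add.mpr (Or.inr ((Multiset.mem_filterMap _ _).mpr
      ⟨⟨n + 1, by omega⟩, Finset.mem_val.mpr (Finset.mem_univ _), ?_⟩))
    rw [dif_pos ⟨Nat.succ_pos n, by simp only; omega, hP⟩]
    rfl
  have reach_mono : ∀ a b, ReachOn V₂ A a b →
      Relation.ReflTransGen (fun a b => a ∈ V₂ ∧ b ∈ V₂ ∧ (a, b) ∈ B) a b := fun a b h =>
    Relation.ReflTransGen.mono
      (fun u v huv => ⟨huv.1, huv.2.1, arc_mem u v huv.1 huv.2.1 huv.2.2⟩) a b h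
  have scc_sub : ∀ i a, a ∈ S i → a ∈ V₂ := by
    intro i a ha
    obtain ⟨v, -, hv⟩ := hscc i
    exact ((hv a).mp ha).1
  have scc_reach : ∀ i a b, a ∈ S i → b ∈ S i → ReachOn V₂ A a b := by
    intro i a b ha hb
    obtain ⟨v, -, hv⟩ := hscc i
    exact ((hv a).mp ha).2.2.trans ((hv b).mp hb).2.1
  have reach_of_le : ∀ i j : Fin k, i ≤ j → ∀ a ∈ S i, ∀ b ∈ S j, ReachOn V₂ A a b := by
    intro i j hij a ha b hb
    rcases hij.eq_or_lt with rfl | hlt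
    · exact scc_reach _ a b ha hb
    · have hne : a ≠ b := fun hab =>
        Finset.disjoint_left.mp (hdisj i j hlt.ne) ha (hab ▸ hb)
      have ha' := scc_sub i a ha
      have hb' := scc_sub j b hb
      exact Relation.ReflTransGen.single
        ⟨ha', hb', (hsemi a ha' b hb' hne).resolve_right (hord i j hlt b hb a ha)⟩
  have hP0V : P 0 ∈ V₂ := scc_sub _ _ hP0
  have arc : ∀ n (h : n + 1 < m + 1), (P ⟨n, by omega⟩, P ⟨n + 1, h⟩) ∈ A := fun n h =>
    hParc ⟨n, by omega⟩
  have along : ∀ n (h : n < m + 1), P ⟨n, h⟩ ∈ V₂ →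
      Relation.ReflTransGen (fun a b => a ∈ V₂ ∧ b ∈ V₂ ∧ (a, b) ∈ B) (P 0) (P ⟨n, h⟩) := by
    intro n
    induction n using Nat.strong_induction_on with
    | _ n ih =>
      intro h hn
      match n, ih, h, hn with
      | 0, _, _, _ => exact Relation.ReflTransGen.refl
      | n + 1, ih, h, hn =>
        by_cases hV : P ⟨n, by omega⟩ ∈ V₁
        · match n, ih, h, hn, hV with
          | 0, _, _, _, hV => exact absurd hP0V (Finset.disjoint_left.mp hdis hV)
          | n + 1, ih, h, hn, hV =>
            have hprev : P ⟨n, by omega⟩ ∈ V₂ := mem_of_not_mem _ fun hmem =>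
              hind _ hmem _ hV (arc n (by omega))
            exact (ih n (by omega) (by omega) hprev).tail ⟨hprev, hn, split_mem n h hV⟩
        · have hprev := mem_of_not_mem _ hV
          exact (ih n (by omega) (by omega) hprev).tail
            ⟨hprev, hn, arc_mem _ _ hprev hn (arc n h)⟩
  intro x hx y hy
  obtain ⟨i, hi⟩ := hcover x hx
  obtain ⟨j, hj⟩ := hcover y hy
  have hfirst := reach_mono _ _ (reach_of_le i _ (Fin.mk_le_mk.mpr (by omega)) x hi _ hP0)
  have hlast := reach_mono _ _ (reach_of_le _ j (Fin.mk_le_mk.mpr (Nat.zero_le _)) _ hPlast y hj)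
  exact (hfirst.trans (along m (by omega) (scc_sub _ _ hPlast))).trans hlast
end
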